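/- For every integer k ≥ 1, the limit Q(β) = lim_{n→∞} (1/n) log ∫_0^1 exp(β F_{k,n}(x)) dx exists for all β ∈ ℝ, the function Q is differentiable at β = 0, and its derivative at β = 0 equals (1/log 2) log((k+1)²/(k(k+2))). Moreover, for every y in the image of π, the analogous limits formed with Σ_{T^n x = x} exp(β F_{k,n}(x))|DT^n(x)|^{-1} and with Σ_{T^n x = y} exp(β F_{k,n}(x))|DT^n(x)|^{-1} in place of the integral exist for all β ∈ ℝ, are differentiable at β = 0, and have the same derivative (1/log 2) log((k+1)²/(k(k+2))) at β = 0. -/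

import Mathlib

open MeasureTheory Filter Topology Set
open scoped ENNReal NNReal

namespace CMS

/-! ### Generic dynamical notions -/

variable {X : Type*}

/-- Birkhoff sum `S_n φ`. -/
noncomputable def birkhoff (T : X → X) (φ : X → ℝ) (n : ℕ) (x : X) : ℝ :=
  ∑ i ∈ Finset.range n, φ (T^[i] x)

/-- A measure is invariant under `T`. -/
def Invariant [MeasurableSpace X] (T : X → X) (μ : Measure X) : Prop :=
  Measure.map T μ = μ

/-- `∫ φ dμ > -∞`, i.e. the negative part of `φ` is integrable. -/
def IntegralGtBot [MeasurableSpace X] (φ : X → ℝ) (μ : Measure X) : Prop :=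
  (∫⁻ x, ENNReal.ofReal (-φ x) ∂μ) ≠ ⊤

/-- The integral of `φ`, with values in `EReal` (defined whenever one of the parts is finite). -/
noncomputable def eintegral [MeasurableSpace X] (φ : X → ℝ) (μ : Measure X) : EReal :=
  ((∫⁻ x, ENNReal.ofReal (φ x) ∂μ : ℝ≥0∞) : EReal) -
    ((∫⁻ x, ENNReal.ofReal (-φ x) ∂μ : ℝ≥0∞) : EReal)

/-- Entropy of the countable partition induced by a map `g` with countable range. -/
noncomputable def partitionEntropy [MeasurableSpace X] {α : Type*} (μ : Measure X) (g : X → α) :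
    ℝ≥0∞ :=
  ∑' a : α, ENNReal.ofReal (-((μ (g ⁻¹' {a})).toReal * Real.log ((μ (g ⁻¹' {a})).toReal)))

/-- Kolmogorov–Sinaĭ entropy of `T` with respect to `μ`: the supremum over finite measurable
partitions (coded by maps `X → ℕ` with finite range) of the asymptotic entropy of iterated
joins of the partition. -/
noncomputable def entropy [MeasurableSpace X] (T : X → X) (μ : Measure X) : ℝ≥0∞ :=
  ⨆ (p : X → ℕ) (_ : Measurable p ∧ (Set.range p).Finite),
    atTop.liminf fun n : ℕ =>
      ENNReal.ofReal ((n : ℝ)⁻¹) * partitionEntropy μ (fun x => fun i : Fin n => p (T^[i] x))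

/-- The empirical measure `δ_x^n = (1/n) ∑_{i<n} δ_{T^i x}` (with junk convention `n = 0 ↦ n = 1`,
irrelevant since only `n ≥ 1` is ever used). -/
noncomputable def empirical [MeasurableSpace X] (T : X → X) (x : X) (n : ℕ) :
    ProbabilityMeasure X :=
  ⟨((max n 1 : ℕ) : ℝ≥0∞)⁻¹ • ∑ i ∈ Finset.range (max n 1), Measure.dirac (T^[i] x), by
    refine ⟨?_⟩
    have h1 : (∑ i ∈ Finset.range (max n 1), Measure.dirac (T^[i] x)) Set.univ
        = ((max n 1 : ℕ) : ℝ≥0∞) := by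
      rw [Measure.finset_sum_apply]
      simp
    rw [Measure.smul_apply, h1, smul_eq_mul, ENNReal.inv_mul_cancel] <;> simp⟩

noncomputable instance [MeasurableSpace X] [TopologicalSpace X] [OpensMeasurableSpace X] :
    MeasurableSpace (ProbabilityMeasure X) := borel _

/-- Sets of periodic points. -/
def perSet (T : X → X) (n : ℕ) : Set X := {x | T^[n] x = x}

/-- Sets of iterated preimages of a point. -/
def preimSet (T : X → X) (n : ℕ) (y : X) : Set X := {x | T^[n] x = y}

/-- The partition function `Z_n(φ, C)` over a subset `C`. -/
noncomputable def Zfn [MeasurableSpace X] (T : X → X) (φ : X → ℝ) (n : ℕ) (C : Set X) : ℝ≥0∞ :=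
  ∑' x : C, ENNReal.ofReal (Real.exp (birkhoff T φ n x))

/-- The distribution of the empirical measures under `μ`. -/
noncomputable def empDistr [MeasurableSpace X] [TopologicalSpace X] [OpensMeasurableSpace X]
    (T : X → X) (μ : Measure X) (n : ℕ) : Measure (ProbabilityMeasure X) :=
  Measure.map (fun x => empirical T x n) μ

/-- The distribution `Z_n(φ,C)⁻¹ ∑_{x ∈ C} e^{S_nφ(x)} δ_{δ_x^n}` on the space of probability
measures, for a countable set `C` (of weighted periodic points or iterated preimages). -/
noncomputable def weightedDistr [MeasurableSpace X] [TopologicalSpace X] [OpensMeasurableSpace X]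
    (T : X → X) (φ : X → ℝ) (n : ℕ) (C : Set X) : Measure (ProbabilityMeasure X) :=
  (Zfn T φ n C)⁻¹ •
    Measure.sum (fun x : C =>
      ENNReal.ofReal (Real.exp (birkhoff T φ n x)) • Measure.dirac (empirical T (x : X) n))

/-! ### Large deviations notions -/

variable {Y : Type*}

/-- The large deviation principle for a sequence of (sub)probability measures with rate
function `J`. -/
def HasLDP [TopologicalSpace Y] [MeasurableSpace Y] (μ : ℕ → Measure Y) (J : Y → EReal) : Prop :=
  (∀ G : Set Y, IsOpen G →
      -(⨅ y ∈ G, J y) ≤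
        atTop.liminf fun n : ℕ => (((n : ℝ)⁻¹ : ℝ) : EReal) * ENNReal.log (μ n G)) ∧
  (∀ K : Set Y, IsClosed K →
      atTop.limsup (fun n : ℕ => (((n : ℝ)⁻¹ : ℝ) : EReal) * ENNReal.log (μ n K)) ≤
        -(⨅ y ∈ K, J y))

/-- Exponential tightness of a sequence of measures. -/
def ExpTight [TopologicalSpace Y] [MeasurableSpace Y] (μ : ℕ → Measure Y) : Prop :=
  ∀ L : ℝ, 0 < L → ∃ K : Set Y, IsCompact K ∧
    atTop.limsup (fun n : ℕ => (((n : ℝ)⁻¹ : ℝ) : EReal) * ENNReal.log (μ n Kᶜ)) ≤ ((-L : ℝ) : EReal)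

/-- A good rate function: lower semicontinuous with compact sublevel sets. -/
def GoodRate [TopologicalSpace Y] (J : Y → EReal) : Prop :=
  LowerSemicontinuous J ∧ ∀ α : ℝ, 0 ≤ α → IsCompact {y | J y ≤ (α : EReal)}

/-- The rate function `I(μ) = - inf_{G ∋ μ} sup_G F`. -/
noncomputable def rateOf [TopologicalSpace Y] (F : Y → EReal) (μ : Y) : EReal :=
  -(⨅ (G : Set Y) (_ : IsOpen G ∧ μ ∈ G), ⨆ ν ∈ G, F ν)

/-- The convex combination `t μ + (1-t) ν` of two probability measures. -/
noncomputable def mix [MeasurableSpace X] (t : ℝ) (h0 : 0 ≤ t) (h1 : t ≤ 1)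
    (μ ν : ProbabilityMeasure X) : ProbabilityMeasure X :=
  ⟨ENNReal.ofReal t • (μ : Measure X) + ENNReal.ofReal (1 - t) • (ν : Measure X), by
    refine ⟨?_⟩
    simp only [Measure.add_apply, Measure.smul_apply, smul_eq_mul, measure_univ, mul_one]
    rw [← ENNReal.ofReal_add h0 (by linarith)]
    norm_num⟩

/-- Convexity of a rate function on probability measures. -/
def ConvexRate [MeasurableSpace X] (J : ProbabilityMeasure X → EReal) : Prop :=
  ∀ μ ν : ProbabilityMeasure X, ∀ t : ℝ, ∀ (h0 : 0 ≤ t) (h1 : t ≤ 1),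
    J (mix t h0 h1 μ ν) ≤ ((t : ℝ) : EReal) * J μ + ((1 - t : ℝ) : EReal) * J ν

-- The free energy functional `F`.
open Classical in
noncomputable def freeEnergy [MeasurableSpace X] (T : X → X) (φ : X → ℝ) (P : ℝ)
    (ν : ProbabilityMeasure X) : EReal :=
  if Invariant T (ν : Measure X) ∧ IntegralGtBot φ (ν : Measure X)
  then ((entropy T (ν : Measure X) : ℝ≥0∞) : EReal) + eintegral φ (ν : Measure X) - ((P : ℝ) : EReal)
  else ⊥

/-! ### Countable Markov shifts -/

variable {S : Type*}

/-- The topological Markov shift with alphabet `S` and transition relation `A`. -/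
def Space (A : S → S → Prop) : Type _ := {x : ℕ → S // ∀ i, A (x i) (x (i + 1))}

variable (A : S → S → Prop)

instance [TopologicalSpace S] : TopologicalSpace (Space A) :=
  inferInstanceAs (TopologicalSpace {x : ℕ → S // ∀ i, A (x i) (x (i + 1))})

noncomputable instance [TopologicalSpace S] : MeasurableSpace (Space A) := borel _

instance [TopologicalSpace S] : BorelSpace (Space A) := ⟨rfl⟩

/-- The left shift. -/
def shift : Space A → Space A := fun x => ⟨fun i => x.1 (i + 1), fun i => x.2 (i + 1)⟩

/-- Admissible words. -/
def Admissible (w : List S) : Prop := w ≠ [] ∧ w.Chain' A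

/-- The cylinder set of a word. -/
def cylinder (w : List S) : Set (Space A) := {x | ∀ i : Fin w.length, x.1 i = w.get i}

variable {A}

/-- The initial word of length `n` of a point. -/
def word (x : Space A) (n : ℕ) : List S := List.ofFn (fun i : Fin n => x.1 i)

variable (A)

/-- `μ` is a Gibbs state for the potential `φ` with constants `c₀` and `P`. -/
def IsGibbsWith [TopologicalSpace S] (φ : Space A → ℝ) (μ : Measure (Space A)) (c₀ P : ℝ) :
    Prop :=
  ∀ n : ℕ, 1 ≤ n → ∀ x : Space A,
    c₀⁻¹ * Real.exp (-(P * n) + birkhoff (shift A) φ n x)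
        ≤ (μ (cylinder A (word x n))).toReal ∧
      (μ (cylinder A (word x n))).toReal
        ≤ c₀ * Real.exp (-(P * n) + birkhoff (shift A) φ n x)

/-- `μ` is a Gibbs state for `φ`. -/
def IsGibbs [TopologicalSpace S] (φ : Space A → ℝ) (μ : Measure (Space A)) : Prop :=
  ∃ c₀ P : ℝ, 1 ≤ c₀ ∧ IsGibbsWith A φ μ c₀ P

/-- The transition matrix has no row or column identically zero. -/
def NoZeroRowCol : Prop := (∀ a : S, ∃ b, A a b) ∧ ∀ b : S, ∃ a, A a b

/-- Finite irreducibility. -/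
def FinitelyIrreducible : Prop :=
  ∃ Λ : Finset (List S), ∀ v w : List S, Admissible A v → Admissible A w →
    ∃ l ∈ Λ, Admissible A (v ++ l ++ w)

/-- Finite primitiveness. -/
def FinitelyPrimitive : Prop :=
  ∃ Λ : Finset (List S), (∃ N : ℕ, ∀ l ∈ Λ, l.length = N) ∧
    ∀ v w : List S, Admissible A v → Admissible A w →
      ∃ l ∈ Λ, Admissible A (v ++ l ++ w)

/-- Topological transitivity. -/
def TopTransitive : Prop :=
  ∀ a b : S, ∃ n : ℕ, 1 ≤ n ∧
    (cylinder A [a] ∩ (shift A)^[n] ⁻¹' (cylinder A [b])).Nonempty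

/-- Varadhan's functional `Q(ψ) = sup_μ (∫ψ dμ - I(μ))`. -/
noncomputable def varQ {X : Type*} [MeasurableSpace X] (I : ProbabilityMeasure X → EReal)
    (ψ : X → ℝ) : EReal :=
  ⨆ μ : ProbabilityMeasure X, (((∫ x, ψ x ∂(μ : Measure X)) : ℝ) : EReal) - I μ

/-- `φ` is uniformly continuous for the standard metric of the shift space. -/
def UnifCont (φ : Space A → ℝ) : Prop :=
  ∀ ε : ℝ, 0 < ε → ∃ N : ℕ, ∀ x y : Space A, (∀ i < N, x.1 i = y.1 i) → |φ x - φ y| ≤ ε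

/-- `φ` is bounded. -/
def Bdd (φ : Space A → ℝ) : Prop := ∃ C : ℝ, ∀ x : Space A, |φ x| ≤ C

end CMS

open CMS MeasureTheory Filter Topology Set
open scoped ENNReal

/-- The Gauss map `T x = 1/x - ⌊1/x⌋`. -/
noncomputable def gaussMap : ℝ → ℝ := fun x => Int.fract x⁻¹

/-- The left shift on the full shift `ℕ^ℕ`. -/
def fullShift : (ℕ → ℕ) → ℕ → ℕ := fun x i => x (i + 1)

/-- The value of the finite continued fraction `[0; a₀ + 1, a₁ + 1, …]`. -/
noncomputable def finCF : List ℕ → ℝ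
  | [] => 0
  | a :: l => ((a : ℝ) + 1 + finCF l)⁻¹

/-- The coding map `π` conjugating the full shift over `ℕ` with the Gauss map: `x` is sent to
the infinite continued fraction with digits `x_i + 1`. -/
noncomputable def cfPi (x : ℕ → ℕ) : ℝ :=
  limUnder atTop (fun n : ℕ => finCF (List.ofFn fun i : Fin n => x i))

/-- The counting function `F_{k,n}(x) = #{1 ≤ i ≤ n : a_i(x) = k}`, expressed via the Gauss
map: `a_i(x) = k` iff `T^{i-1} x ∈ (1/(k+1), 1/k)`. -/
noncomputable def digitCount (k n : ℕ) (x : ℝ) : ℕ :=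
  Set.ncard {i : ℕ | i < n ∧ gaussMap^[i] x ∈ Set.Ioo (((k : ℝ) + 1)⁻¹) ((k : ℝ)⁻¹)}

/-- The potential `φ = -log |DT ∘ π|` on the full shift. -/
noncomputable def gaussPotential (x : ℕ → ℕ) : ℝ :=
  -Real.log |deriv gaussMap (cfPi x)|

namespace GaussFreeEnergy

/-! ### Inverse branches of the Gauss map -/

/-- The inverse branch of the Gauss map whose image has first digit `a + 1`. -/
noncomputable def branch (a : ℕ) (y : ℝ) : ℝ := ((a : ℝ) + 1 + y)⁻¹

/-- The first continued fraction digit, minus one. -/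
noncomputable def digit (x : ℝ) : ℕ := ⌊x⁻¹⌋₊ - 1

/-- The indicator of the digit `a + 1` being equal to `k`. -/
def digitInd (k a : ℕ) : ℝ := if a + 1 = k then 1 else 0

lemma digitInd_nonneg (k a : ℕ) : 0 ≤ digitInd k a := by
  unfold digitInd; split_ifs <;> norm_num

lemma digitInd_le_one (k a : ℕ) : digitInd k a ≤ 1 := by
  unfold digitInd; split_ifs <;> norm_num

lemma branch_pos (a : ℕ) {y : ℝ} (hy : 0 ≤ y) : 0 < branch a y := by
  unfold branch; positivity

lemma branch_le_one (a : ℕ) {y : ℝ} (hy : 0 ≤ y) : branch a y ≤ 1 := by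
  unfold branch
  have ha : (0 : ℝ) ≤ a := a.cast_nonneg
  exact inv_le_one_of_one_le₀ (by linarith)

lemma branch_lt_one (a : ℕ) {y : ℝ} (hy : 0 < y) : branch a y < 1 := by
  unfold branch
  have ha : (0 : ℝ) ≤ a := a.cast_nonneg
  exact inv_lt_one_of_one_lt₀ (by linarith)

lemma branch_mem_Icc (a : ℕ) {y : ℝ} (hy : y ∈ Icc (0 : ℝ) 1) : branch a y ∈ Icc (0 : ℝ) 1 :=
  ⟨(branch_pos a hy.1).le, branch_le_one a hy.1⟩

lemma branch_mem_Ioo (a : ℕ) {y : ℝ} (hy : y ∈ Ioo (0 : ℝ) 1) : branch a y ∈ Ioo (0 : ℝ) 1 :=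
  ⟨branch_pos a hy.1.le, branch_lt_one a hy.1⟩

lemma measurable_branch (a : ℕ) : Measurable (branch a) := by
  unfold branch; fun_prop

lemma continuousOn_branch (a : ℕ) : ContinuousOn (branch a) (Icc 0 1) := by
  unfold branch
  refine ContinuousOn.inv₀ (by fun_prop) fun y hy => ?_
  have ha : (0 : ℝ) ≤ a := a.cast_nonneg
  linarith [hy.1]

lemma hasDerivAt_branch (a : ℕ) {y : ℝ} (hy : 0 ≤ y) :
    HasDerivAt (branch a) (-(branch a y ^ 2)) y := by
  have ha : (0 : ℝ) ≤ a := a.cast_nonneg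
  have h : HasDerivAt (fun z : ℝ => (a : ℝ) + 1 + z) 1 y := (hasDerivAt_id y).const_add _
  exact (h.inv (by linarith)).congr_deriv (by rw [branch, inv_pow, neg_div, one_div])

lemma abs_branch_sub_branch (a : ℕ) {x y : ℝ} (hx : 0 ≤ x) (hy : 0 ≤ y) :
    |branch a x - branch a y| = |x - y| * (branch a x * branch a y) := by
  have ha : (0 : ℝ) ≤ a := a.cast_nonneg
  have h : branch a x - branch a y = (y - x) * (branch a x * branch a y) := by
    unfold branch
    have : (a : ℝ) + 1 + x ≠ 0 := by linarith
    have : (a : ℝ) + 1 + y ≠ 0 := by linarith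
    field_simp
    ring
  rw [h, abs_mul, abs_of_pos (mul_pos (branch_pos a hx) (branch_pos a hy)), abs_sub_comm]

lemma branch_antitone (a : ℕ) {x y : ℝ} (hx : 0 ≤ x) (hxy : x ≤ y) : branch a y ≤ branch a x := by
  unfold branch
  have ha : (0 : ℝ) ≤ a := a.cast_nonneg
  exact inv_anti₀ (by linarith) (by linarith)

lemma branch_antitone_digit {a b : ℕ} (hab : a ≤ b) {x : ℝ} (hx : 0 ≤ x) :
    branch b x ≤ branch a x := by
  unfold branch
  have ha : (0 : ℝ) ≤ a := a.cast_nonneg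
  have hab' : (a : ℝ) ≤ b := Nat.cast_le.2 hab
  exact inv_anti₀ (by linarith) (by linarith)

lemma gaussMap_branch (a : ℕ) {y : ℝ} (hy : y ∈ Ioo (0 : ℝ) 1) : gaussMap (branch a y) = y := by
  unfold gaussMap branch
  rw [inv_inv, show (a : ℝ) + 1 + y = y + ((a + 1 : ℕ) : ℝ) by push_cast; ring,
    Int.fract_add_natCast]
  exact Int.fract_eq_self.2 ⟨hy.1.le, hy.2⟩

lemma digit_branch (a : ℕ) {y : ℝ} (hy : y ∈ Ioo (0 : ℝ) 1) : digit (branch a y) = a := by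
  unfold digit branch
  rw [inv_inv, show (a : ℝ) + 1 + y = y + ((a + 1 : ℕ) : ℝ) by push_cast; ring,
    Nat.floor_add_natCast hy.1.le, Nat.floor_eq_zero.2 hy.2]
  simp

lemma branch_digit {x : ℝ} (hx : x ∈ Ioo (0 : ℝ) 1) : branch (digit x) (gaussMap x) = x := by
  have h1 : 1 ≤ x⁻¹ := (one_le_inv₀ hx.1).2 hx.2.le
  have h2 : 1 ≤ ⌊x⁻¹⌋₊ := Nat.le_floor (by simpa using h1)
  unfold branch digit gaussMap
  rw [Nat.cast_sub h2, Nat.cast_one, sub_add_cancel, Int.fract,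
    ← natCast_floor_eq_intCast_floor (by linarith)]
  simp

lemma branch_mem_digit_interval_iff {k : ℕ} (hk : 1 ≤ k) (a : ℕ) {y : ℝ}
    (hy : y ∈ Ioo (0 : ℝ) 1) :
    branch a y ∈ Ioo (((k : ℝ) + 1)⁻¹) ((k : ℝ)⁻¹) ↔ a + 1 = k := by
  have ha : (0 : ℝ) ≤ a := a.cast_nonneg
  have hk' : (1 : ℝ) ≤ k := by exact_mod_cast hk
  unfold branch
  rw [mem_Ioo, inv_lt_inv₀ (by linarith) (by linarith [hy.1]),
    inv_lt_inv₀ (by linarith [hy.1]) (by linarith)]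
  constructor
  · rintro ⟨h1, h2⟩
    have h3 : (a : ℝ) < k := by linarith [hy.1]
    have h4 : (k : ℝ) < a + 2 := by linarith [hy.2]
    have h3' : a < k := by exact_mod_cast h3
    have h4' : k < a + 2 := by exact_mod_cast h4
    omega
  · rintro rfl
    push_cast
    exact ⟨by linarith [hy.2], by linarith [hy.1]⟩

lemma irrational_branch (a : ℕ) {y : ℝ} (hy : Irrational y) : Irrational (branch a y) := by
  unfold branch
  refine Irrational.inv ?_
  rw [show (a : ℝ) + 1 + y = ((a + 1 : ℕ) : ℝ) + y by push_cast; ring]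
  exact irrational_natCast_add_iff.2 hy

lemma irrational_gaussMap {x : ℝ} (hx : Irrational x) : Irrational (gaussMap x) := by
  unfold gaussMap Int.fract
  exact irrational_sub_intCast_iff.2 hx.inv

lemma gaussMap_mem_Ioo {x : ℝ} (hx : Irrational x) : gaussMap x ∈ Ioo (0 : ℝ) 1 :=
  ⟨lt_of_le_of_ne (Int.fract_nonneg _) (irrational_gaussMap hx).ne_zero.symm,
    Int.fract_lt_one _⟩

lemma hasDerivAt_gaussMap_branch (a : ℕ) {y : ℝ} (hy : y ∈ Ioo (0 : ℝ) 1) :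
    HasDerivAt gaussMap (-(branch a y ^ 2)⁻¹) (branch a y) := by
  have hb := branch_pos a hy.1.le
  have h : HasDerivAt (fun x : ℝ => x⁻¹ - ((a : ℝ) + 1)) (-(branch a y ^ 2)⁻¹) (branch a y) :=
    (hasDerivAt_inv hb.ne').sub_const _
  refine h.congr_of_eventuallyEq ?_
  have hc : ContinuousAt (fun x : ℝ => x⁻¹) (branch a y) := continuousAt_inv₀ hb.ne'
  have hmem : Ioo ((a : ℝ) + 1) (a + 2) ∈ 𝓝 ((branch a y)⁻¹) := by
    refine Ioo_mem_nhds ?_ ?_ <;> unfold branch <;> rw [inv_inv] <;> linarith [hy.1, hy.2]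
  filter_upwards [hc hmem] with x hx
  have hfl : ⌊x⁻¹⌋ = (a : ℤ) + 1 := by
    rw [Int.floor_eq_iff]
    push_cast
    exact ⟨hx.1.le, by linarith [hx.2]⟩
  unfold gaussMap Int.fract
  rw [hfl]
  push_cast
  rfl

lemma measurable_gaussMap : Measurable gaussMap := by
  unfold gaussMap; fun_prop

/-! ### The digit count -/

lemma digitCount_zero (k : ℕ) (x : ℝ) : digitCount k 0 x = 0 := by
  simp [digitCount]

open Classical in
lemma digitCount_eq_sum (k n : ℕ) (x : ℝ) :
    digitCount k n x = ∑ i ∈ Finset.range n,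
      if gaussMap^[i] x ∈ Ioo (((k : ℝ) + 1)⁻¹) ((k : ℝ)⁻¹) then 1 else 0 := by
  rw [Finset.sum_boole, digitCount, ← Set.ncard_coe_finset]
  simp

lemma measurable_digitCount (k n : ℕ) : Measurable (digitCount k n) := by
  classical
  rw [show digitCount k n = _ from funext (digitCount_eq_sum k n)]
  refine Finset.measurable_sum _ fun i _ => Measurable.ite ?_ measurable_const measurable_const
  exact (measurable_gaussMap.iterate i) measurableSet_Ioo

lemma digitCount_succ_branch {k : ℕ} (hk : 1 ≤ k) (n a : ℕ) {y : ℝ} (hy : y ∈ Ioo (0 : ℝ) 1) :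
    (digitCount k (n + 1) (branch a y) : ℝ) = digitInd k a + digitCount k n y := by
  classical
  rw [digitCount_eq_sum, digitCount_eq_sum, Finset.sum_range_succ']
  simp only [Function.iterate_succ_apply, gaussMap_branch a hy, Function.iterate_zero, id,
    branch_mem_digit_interval_iff hk a hy, digitInd]
  push_cast
  ring

lemma digitCount_succ {k : ℕ} (n : ℕ) {x z : ℝ} {a : ℕ} (hk : 1 ≤ k) (hz : z ∈ Ioo (0 : ℝ) 1)
    (hx : gaussMap^[n] x = branch a z) :
    (digitCount k (n + 1) x : ℝ) = digitInd k a + digitCount k n x := by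
  classical
  rw [digitCount_eq_sum, digitCount_eq_sum, Finset.sum_range_succ]
  simp only [hx, branch_mem_digit_interval_iff hk a hz, digitInd]
  push_cast
  ring

/-! ### Compositions of inverse branches

A word `w` of length `n` encodes the inverse branch `branch (w (n-1)) ∘ ⋯ ∘ branch (w 0)` of the
`n`-th iterate of the Gauss map; the last continued fraction digit comes first. -/

/-- The inverse branch of the `n`-th iterate of the Gauss map encoded by a word. -/
noncomputable def wordMap : (n : ℕ) → (Fin n → ℕ) → ℝ → ℝ
  | 0, _, y => y
  | n + 1, w, y => wordMap n (Fin.tail w) (branch (w 0) y)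

/-- The square root of the absolute value of the derivative of `wordMap`. -/
noncomputable def wordScale : (n : ℕ) → (Fin n → ℕ) → ℝ → ℝ
  | 0, _, _ => 1
  | n + 1, w, y => branch (w 0) y * wordScale n (Fin.tail w) (branch (w 0) y)

/-- The number of occurrences of the continued fraction digit `k` in a word. -/
noncomputable def wordCount (k : ℕ) : (n : ℕ) → (Fin n → ℕ) → ℝ
  | 0, _ => 0
  | n + 1, w => digitInd k (w 0) + wordCount k n (Fin.tail w)

/-- The weight of a word at a point. -/
noncomputable def wordWeight (β : ℝ) (k n : ℕ) (w : Fin n → ℕ) (y : ℝ) : ℝ :=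
  Real.exp (β * wordCount k n w) * wordScale n w y ^ 2

/-- The first `n` digits of a point, the last one first. -/
noncomputable def digits : (n : ℕ) → ℝ → Fin n → ℕ
  | 0, _ => Fin.elim0
  | n + 1, x => Fin.cons (digit (gaussMap^[n] x)) (digits n x)

lemma wordMap_mem_Icc (n : ℕ) (w : Fin n → ℕ) {y : ℝ} (hy : y ∈ Icc (0 : ℝ) 1) :
    wordMap n w y ∈ Icc (0 : ℝ) 1 := by
  induction n generalizing y with
  | zero => exact hy
  | succ n ih => exact ih _ (branch_mem_Icc _ hy)

lemma wordMap_mem_Ioo (n : ℕ) (w : Fin n → ℕ) {y : ℝ} (hy : y ∈ Ioo (0 : ℝ) 1) :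
    wordMap n w y ∈ Ioo (0 : ℝ) 1 := by
  induction n generalizing y with
  | zero => exact hy
  | succ n ih => exact ih _ (branch_mem_Ioo _ hy)

lemma wordMap_pos (n : ℕ) (w : Fin n → ℕ) {y : ℝ} (hy : 0 < y) : 0 < wordMap n w y := by
  induction n generalizing y with
  | zero => exact hy
  | succ n ih => exact ih _ (branch_pos _ hy.le)

lemma irrational_wordMap (n : ℕ) (w : Fin n → ℕ) {y : ℝ} (hy : Irrational y) :
    Irrational (wordMap n w y) := by
  induction n generalizing y with
  | zero => exact hy
  | succ n ih => exact ih _ (irrational_branch _ hy)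

lemma continuousOn_wordMap (n : ℕ) (w : Fin n → ℕ) : ContinuousOn (wordMap n w) (Icc 0 1) := by
  induction n with
  | zero => exact continuousOn_id
  | succ n ih => exact (ih _).comp (continuousOn_branch _) fun y hy => branch_mem_Icc _ hy

lemma iterate_gaussMap_wordMap (n : ℕ) (w : Fin n → ℕ) {y : ℝ} (hy : y ∈ Ioo (0 : ℝ) 1) :
    gaussMap^[n] (wordMap n w y) = y := by
  induction n generalizing y with
  | zero => rfl
  | succ n ih =>
    rw [Function.iterate_succ_apply', wordMap, ih _ (branch_mem_Ioo _ hy), gaussMap_branch _ hy]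

lemma digits_wordMap (n : ℕ) (w : Fin n → ℕ) {y : ℝ} (hy : y ∈ Ioo (0 : ℝ) 1) :
    digits n (wordMap n w y) = w := by
  induction n generalizing y with
  | zero => exact Subsingleton.elim _ _
  | succ n ih =>
    rw [digits, wordMap, iterate_gaussMap_wordMap _ _ (branch_mem_Ioo _ hy), digit_branch _ hy,
      ih _ (branch_mem_Ioo _ hy), Fin.cons_self_tail]

lemma iterate_gaussMap_mem {x : ℝ} (hx : x ∈ Ioo (0 : ℝ) 1) (hi : Irrational x) (n : ℕ) :
    gaussMap^[n] x ∈ Ioo (0 : ℝ) 1 ∧ Irrational (gaussMap^[n] x) := by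
  induction n with
  | zero => exact ⟨hx, hi⟩
  | succ n ih =>
    rw [Function.iterate_succ_apply']
    exact ⟨gaussMap_mem_Ioo ih.2, irrational_gaussMap ih.2⟩

lemma wordMap_digits {x : ℝ} (hx : x ∈ Ioo (0 : ℝ) 1) (hi : Irrational x) (n : ℕ) :
    wordMap n (digits n x) (gaussMap^[n] x) = x := by
  induction n with
  | zero => rfl
  | succ n ih =>
    rw [digits, wordMap, Fin.tail_cons, Fin.cons_zero, Function.iterate_succ_apply',
      branch_digit (iterate_gaussMap_mem hx hi n).1, ih]

lemma digitCount_wordMap {k : ℕ} (hk : 1 ≤ k) (n : ℕ) (w : Fin n → ℕ) {y : ℝ}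
    (hy : y ∈ Ioo (0 : ℝ) 1) : (digitCount k n (wordMap n w y) : ℝ) = wordCount k n w := by
  induction n generalizing y with
  | zero => simp [digitCount_zero, wordCount]
  | succ n ih =>
    have hb := branch_mem_Ioo (w 0) hy
    rw [wordMap, digitCount_succ n hk hy (iterate_gaussMap_wordMap n (Fin.tail w) hb), ih _ hb,
      wordCount]

lemma hasDerivAt_iterate_gaussMap (n : ℕ) (w : Fin n → ℕ) {y : ℝ} (hy : y ∈ Ioo (0 : ℝ) 1) :
    ∃ d, HasDerivAt (gaussMap^[n]) d (wordMap n w y) ∧ |d|⁻¹ = wordScale n w y ^ 2 := by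
  induction n generalizing y with
  | zero => exact ⟨1, hasDerivAt_id _, by simp [wordScale]⟩
  | succ n ih =>
    have hb := branch_mem_Ioo (w 0) hy
    obtain ⟨d, hd, hd'⟩ := ih (Fin.tail w) hb
    have hT := hasDerivAt_gaussMap_branch (w 0) hy
    refine ⟨-(branch (w 0) y ^ 2)⁻¹ * d, ?_, ?_⟩
    · rw [wordMap, Function.iterate_succ']
      refine HasDerivAt.comp _ ?_ hd
      rwa [iterate_gaussMap_wordMap n (Fin.tail w) hb]
    · rw [abs_mul, mul_inv, hd', abs_neg, abs_of_pos (by have := hb.1; positivity), inv_inv,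
        wordScale]
      ring

lemma weight_wordMap {k : ℕ} (hk : 1 ≤ k) (β : ℝ) (n : ℕ) (w : Fin n → ℕ) {y : ℝ}
    (hy : y ∈ Ioo (0 : ℝ) 1) :
    Real.exp (β * (digitCount k n (wordMap n w y) : ℝ)) * |deriv (gaussMap^[n]) (wordMap n w y)|⁻¹
      = wordWeight β k n w y := by
  obtain ⟨d, hd, hd'⟩ := hasDerivAt_iterate_gaussMap n w hy
  rw [hd.deriv, hd', digitCount_wordMap hk n w hy, wordWeight]

lemma wordWeight_nonneg (β : ℝ) (k n : ℕ) (w : Fin n → ℕ) (y : ℝ) : 0 ≤ wordWeight β k n w y := by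
  unfold wordWeight; positivity

/-! ### Bounded distortion -/

lemma exists_wordScale_eq (n : ℕ) (w : Fin n → ℕ) :
    ∃ q q' : ℝ, 0 < q ∧ 0 ≤ q' ∧ q' ≤ q ∧ ∀ y, 0 ≤ y → wordScale n w y = (q + q' * y)⁻¹ := by
  induction n with
  | zero => exact ⟨1, 0, by norm_num, le_rfl, by norm_num, fun y _ => by simp [wordScale]⟩
  | succ n ih =>
    obtain ⟨q, q', hq, hq', hle, h⟩ := ih (Fin.tail w)
    have ha : (0 : ℝ) ≤ w 0 := (w 0).cast_nonneg
    refine ⟨q * (w 0 + 1) + q', q, by positivity, hq.le, by nlinarith [mul_nonneg hq.le ha],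
      fun y hy => ?_⟩
    rw [wordScale, h _ (branch_pos _ hy).le, branch, ← mul_inv]
    have : (w 0 : ℝ) + 1 + y ≠ 0 := by positivity
    congr 1
    field_simp
    ring

lemma wordScale_nonneg (n : ℕ) (w : Fin n → ℕ) {y : ℝ} (hy : 0 ≤ y) : 0 ≤ wordScale n w y := by
  obtain ⟨q, q', hq, hq', -, h⟩ := exists_wordScale_eq n w
  rw [h y hy]
  positivity

lemma wordScale_le_two_mul (n : ℕ) (w : Fin n → ℕ) {x y : ℝ} (hx : x ∈ Icc (0 : ℝ) 1)
    (hy : y ∈ Icc (0 : ℝ) 1) : wordScale n w x ≤ 2 * wordScale n w y := by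
  obtain ⟨q, q', hq, hq', hle, h⟩ := exists_wordScale_eq n w
  rw [h x hx.1, h y hy.1, ← div_eq_mul_inv, inv_eq_one_div, div_le_div_iff₀
    (by nlinarith [mul_nonneg hq' hx.1]) (by nlinarith [mul_nonneg hq' hy.1])]
  nlinarith [mul_nonneg hq' hx.1, mul_le_mul_of_nonneg_left hy.2 hq']

lemma wordWeight_le_four_mul (β : ℝ) (k n : ℕ) (w : Fin n → ℕ) {x y : ℝ}
    (hx : x ∈ Icc (0 : ℝ) 1) (hy : y ∈ Icc (0 : ℝ) 1) :
    wordWeight β k n w x ≤ 4 * wordWeight β k n w y := by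
  unfold wordWeight
  have h := pow_le_pow_left₀ (wordScale_nonneg n w hx.1) (wordScale_le_two_mul n w hx hy) 2
  nlinarith [mul_le_mul_of_nonneg_left h (Real.exp_pos (β * wordCount k n w)).le]

/-! ### The transfer operator -/

/-- The Ruelle transfer operator of the Gauss map with potential
`-log |DT|` plus `β` times the indicator of the digit `k`. -/
noncomputable def transfer (β : ℝ) (k : ℕ) (f : ℝ → ℝ≥0∞) (y : ℝ) : ℝ≥0∞ :=
  ∑' a : ℕ, ENNReal.ofReal (Real.exp (β * digitInd k a) * branch a y ^ 2) * f (branch a y)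

/-- The partition function `∑_{T^n x = y} exp(β F_{k,n}(x)) |DT^n(x)|⁻¹`. -/
noncomputable def partitionFn (β : ℝ) (k n : ℕ) : ℝ → ℝ≥0∞ := (transfer β k)^[n] fun _ => 1

lemma partitionFn_eq_tsum (β : ℝ) (k n : ℕ) (y : ℝ) :
    partitionFn β k n y = ∑' w : Fin n → ℕ, ENNReal.ofReal (wordWeight β k n w y) := by
  unfold partitionFn
  induction n generalizing y with
  | zero => simp [wordWeight, wordScale, wordCount]
  | succ n ih =>
    rw [Function.iterate_succ_apply', transfer, ← (Fin.consEquiv fun _ => ℕ).tsum_eq,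
      ENNReal.tsum_prod']
    refine tsum_congr fun a => ?_
    rw [ih, ← ENNReal.tsum_mul_left]
    refine tsum_congr fun w => ?_
    rw [← ENNReal.ofReal_mul (by positivity)]
    rw [show Fin.consEquiv (fun _ => ℕ) (a, w) = (Fin.cons a w : Fin (n + 1) → ℕ) from rfl]
    congr 1
    simp only [wordWeight, wordScale, wordCount, Fin.cons_zero, Fin.tail_cons, mul_add,
      Real.exp_add]
    ring

lemma partitionFn_le_four_mul (β : ℝ) (k n : ℕ) {x y : ℝ} (hx : x ∈ Icc (0 : ℝ) 1)
    (hy : y ∈ Icc (0 : ℝ) 1) : partitionFn β k n x ≤ 4 * partitionFn β k n y := by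
  rw [partitionFn_eq_tsum, partitionFn_eq_tsum, ← ENNReal.tsum_mul_left]
  refine ENNReal.tsum_le_tsum fun w => ?_
  rw [show (4 : ℝ≥0∞) = ENNReal.ofReal 4 by norm_num, ← ENNReal.ofReal_mul (by norm_num)]
  exact ENNReal.ofReal_le_ofReal (wordWeight_le_four_mul β k n w hx hy)

lemma transfer_mono {β : ℝ} {k : ℕ} {f g : ℝ → ℝ≥0∞} (h : ∀ y ∈ Icc (0 : ℝ) 1, f y ≤ g y) :
    ∀ y ∈ Icc (0 : ℝ) 1, transfer β k f y ≤ transfer β k g y := fun _ hy =>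
  ENNReal.tsum_le_tsum fun a => mul_le_mul_right (h _ (branch_mem_Icc a hy)) _

lemma iterate_transfer_mono {β : ℝ} {k : ℕ} (n : ℕ) {f g : ℝ → ℝ≥0∞}
    (h : ∀ y ∈ Icc (0 : ℝ) 1, f y ≤ g y) :
    ∀ y ∈ Icc (0 : ℝ) 1, (transfer β k)^[n] f y ≤ (transfer β k)^[n] g y := by
  induction n with
  | zero => exact h
  | succ n ih =>
    rw [Function.iterate_succ_apply', Function.iterate_succ_apply']
    exact transfer_mono ih

lemma transfer_const_mul (β : ℝ) (k : ℕ) (c : ℝ≥0∞) (f : ℝ → ℝ≥0∞) :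
    transfer β k (fun y => c * f y) = fun y => c * transfer β k f y := by
  funext y
  rw [transfer, transfer, ← ENNReal.tsum_mul_left]
  exact tsum_congr fun a => by ring

lemma iterate_transfer_const_mul (β : ℝ) (k n : ℕ) (c : ℝ≥0∞) (f : ℝ → ℝ≥0∞) :
    (transfer β k)^[n] (fun y => c * f y) = fun y => c * (transfer β k)^[n] f y := by
  induction n with
  | zero => rfl
  | succ n ih => simp only [Function.iterate_succ_apply', ih, transfer_const_mul]

lemma partitionFn_add_le (β : ℝ) (k m n : ℕ) :
    partitionFn β k (m + n) 0 ≤ 4 * (partitionFn β k m 0 * partitionFn β k n 0) := by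
  have h0 : (0 : ℝ) ∈ Icc (0 : ℝ) 1 := by simp
  have h := iterate_transfer_mono (β := β) (k := k) m
    (f := partitionFn β k n) (g := fun _ => (4 * partitionFn β k n 0) * 1)
    (fun y hy => by simpa using partitionFn_le_four_mul β k n hy h0) 0 h0
  rw [iterate_transfer_const_mul] at h
  rw [partitionFn, Function.iterate_add_apply]
  refine h.trans (le_of_eq ?_)
  change 4 * partitionFn β k n 0 * partitionFn β k m 0 = _
  ring

/-! ### Comparison with super- and subsolutions -/

lemma iterate_transfer_le {β : ℝ} {k : ℕ} {φ : ℝ → ℝ≥0∞} {r : ℝ≥0∞}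
    (h : ∀ y ∈ Icc (0 : ℝ) 1, transfer β k φ y ≤ r * φ y) (n : ℕ) :
    ∀ y ∈ Icc (0 : ℝ) 1, (transfer β k)^[n] φ y ≤ r ^ n * φ y := by
  induction n with
  | zero => simp
  | succ n ih =>
    intro y hy
    rw [Function.iterate_succ_apply']
    refine (transfer_mono ih y hy).trans ?_
    rw [transfer_const_mul, pow_succ, mul_assoc]
    exact mul_le_mul_right (h y hy) _

lemma le_iterate_transfer {β : ℝ} {k : ℕ} {φ : ℝ → ℝ≥0∞} {r : ℝ≥0∞}
    (h : ∀ y ∈ Icc (0 : ℝ) 1, r * φ y ≤ transfer β k φ y) (n : ℕ) :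
    ∀ y ∈ Icc (0 : ℝ) 1, r ^ n * φ y ≤ (transfer β k)^[n] φ y := by
  induction n with
  | zero => simp
  | succ n ih =>
    intro y hy
    rw [Function.iterate_succ_apply']
    refine le_trans ?_ (transfer_mono ih y hy)
    rw [transfer_const_mul, pow_succ, mul_assoc]
    exact mul_le_mul_right (h y hy) _

lemma partitionFn_le {β : ℝ} {k : ℕ} {φ : ℝ → ℝ} {c C r : ℝ} (hc : 0 < c)
    (hφ : ∀ y ∈ Icc (0 : ℝ) 1, c ≤ φ y ∧ φ y ≤ C) (hr : 0 ≤ r)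
    (h : ∀ y ∈ Icc (0 : ℝ) 1, transfer β k (fun y => ENNReal.ofReal (φ y)) y ≤
      ENNReal.ofReal (r * φ y)) (n : ℕ) :
    partitionFn β k n 0 ≤ ENNReal.ofReal (C / c * r ^ n) := by
  have h0 : (0 : ℝ) ∈ Icc (0 : ℝ) 1 := by simp
  have h1 := iterate_transfer_le (r := ENNReal.ofReal r)
    (fun y hy => (h y hy).trans_eq (ENNReal.ofReal_mul hr)) n 0 h0
  have h2 := iterate_transfer_mono (β := β) (k := k) n (f := fun _ => 1)
    (g := fun y => ENNReal.ofReal c⁻¹ * ENNReal.ofReal (φ y)) (fun y hy => by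
      rw [← ENNReal.ofReal_mul (by positivity), ← ENNReal.ofReal_one]
      refine ENNReal.ofReal_le_ofReal ?_
      rw [inv_mul_eq_div, le_div_iff₀ hc, one_mul]
      exact (hφ y hy).1) 0 h0
  rw [iterate_transfer_const_mul] at h2
  refine h2.trans ((mul_le_mul_right h1 _).trans ?_)
  rw [← ENNReal.ofReal_pow hr, ← ENNReal.ofReal_mul (by positivity),
    ← ENNReal.ofReal_mul (by positivity)]
  refine ENNReal.ofReal_le_ofReal ?_
  have : r ^ n * φ 0 ≤ r ^ n * C := mul_le_mul_of_nonneg_left (hφ 0 h0).2 (by positivity)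
  calc c⁻¹ * (r ^ n * φ 0) ≤ c⁻¹ * (r ^ n * C) := mul_le_mul_of_nonneg_left this (by positivity)
    _ = _ := by ring

lemma le_partitionFn {β : ℝ} {k : ℕ} {φ : ℝ → ℝ} {c C r : ℝ} (hc : 0 < c)
    (hφ : ∀ y ∈ Icc (0 : ℝ) 1, c ≤ φ y ∧ φ y ≤ C) (hr : 0 ≤ r)
    (h : ∀ y ∈ Icc (0 : ℝ) 1, ENNReal.ofReal (r * φ y) ≤
      transfer β k (fun y => ENNReal.ofReal (φ y)) y) (n : ℕ) :
    ENNReal.ofReal (c / C * r ^ n) ≤ partitionFn β k n 0 := by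
  have h0 : (0 : ℝ) ∈ Icc (0 : ℝ) 1 := by simp
  have hC : 0 < C := hc.trans_le ((hφ 0 h0).1.trans (hφ 0 h0).2)
  have h1 := le_iterate_transfer (r := ENNReal.ofReal r)
    (fun y hy => (ENNReal.ofReal_mul hr).symm.trans_le (h y hy)) n 0 h0
  have h2 := iterate_transfer_mono (β := β) (k := k) n
    (f := fun y => ENNReal.ofReal C⁻¹ * ENNReal.ofReal (φ y)) (g := fun _ => 1) (fun y hy => by
      rw [← ENNReal.ofReal_mul (by positivity), ← ENNReal.ofReal_one]
      refine ENNReal.ofReal_le_ofReal ?_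
      rw [inv_mul_eq_div, div_le_one hC]
      exact (hφ y hy).2) 0 h0
  rw [iterate_transfer_const_mul] at h2
  refine le_trans ?_ ((mul_le_mul_right h1 _).trans h2)
  rw [← ENNReal.ofReal_pow hr, ← ENNReal.ofReal_mul (by positivity),
    ← ENNReal.ofReal_mul (by positivity)]
  refine ENNReal.ofReal_le_ofReal ?_
  have : r ^ n * c ≤ r ^ n * φ 0 := mul_le_mul_of_nonneg_left (hφ 0 h0).1 (by positivity)
  calc c / C * r ^ n = C⁻¹ * (r ^ n * c) := by ring
    _ ≤ _ := mul_le_mul_of_nonneg_left this (by positivity)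

/-! ### Irrationality of points with infinite orbits -/

lemma irrational_of_forall_iterate_pos {x : ℝ} (h : ∀ i, 0 < gaussMap^[i] x) : Irrational x := by
  rintro ⟨q, rfl⟩
  induction hN : q.num.toNat using Nat.strong_induction_on generalizing q with
  | _ N ih =>
    have hq : 0 < q := by simpa using h 0
    have hT : gaussMap (q : ℝ) = ((Int.fract q⁻¹ : ℚ) : ℝ) := by
      rw [Rat.cast_fract, Rat.cast_inv, gaussMap]
    have hlt := Rat.fract_inv_num_lt_num_of_pos hq
    have hpos := Rat.num_pos.2 hq
    refine ih _ ?_ (Int.fract q⁻¹) (fun i => ?_) rfl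
    · omega
    · rw [← hT, ← Function.iterate_succ_apply]
      exact h (i + 1)

lemma gaussMap_zero : gaussMap 0 = 0 := by simp [gaussMap]

lemma irrational_of_periodic {x : ℝ} {n : ℕ} (hn : 1 ≤ n) (hx : 0 < x) (h : gaussMap^[n] x = x) :
    Irrational x := by
  refine irrational_of_forall_iterate_pos fun i => ?_
  have hne : gaussMap^[i] x ≠ 0 := fun h0 => by
    have h1 : gaussMap^[n * i] x = x := by
      rw [Function.iterate_mul]
      exact Function.iterate_fixed h i
    have h2 : i ≤ n * i := Nat.le_mul_of_pos_left i hn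
    obtain ⟨j, hj⟩ := Nat.exists_eq_add_of_le' h2
    rw [hj, Function.iterate_add_apply, h0, Function.iterate_fixed gaussMap_zero] at h1
    exact hx.ne h1
  cases i with
  | zero => exact hx
  | succ i =>
    rw [Function.iterate_succ_apply'] at hne ⊢
    exact lt_of_le_of_ne (Int.fract_nonneg _) hne.symm

/-! ### The image of the coding map -/

lemma finCF_mem_Icc (l : List ℕ) : finCF l ∈ Icc (0 : ℝ) 1 := by
  induction l with
  | nil => simp [finCF]
  | cons a l ih => exact branch_mem_Icc a ih

/-- The `n`-th convergent of an infinite continued fraction. -/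
noncomputable def convergent (x : ℕ → ℕ) (n : ℕ) : ℝ := finCF (List.ofFn fun i : Fin n => x i)

lemma convergent_mem_Icc (x : ℕ → ℕ) (n : ℕ) : convergent x n ∈ Icc (0 : ℝ) 1 := finCF_mem_Icc _

lemma convergent_succ (x : ℕ → ℕ) (n : ℕ) :
    convergent x (n + 1) = branch (x 0) (convergent (fullShift x) n) := by
  rw [convergent, List.ofFn_succ]
  rfl

lemma abs_branch_branch_sub_le (a b : ℕ) {x y : ℝ} (hx : x ∈ Icc (0 : ℝ) 1)
    (hy : y ∈ Icc (0 : ℝ) 1) :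
    |branch a (branch b x) - branch a (branch b y)| ≤ 1 / 2 * |x - y| := by
  have key : ∀ z ∈ Icc (0 : ℝ) 1, 0 ≤ branch a (branch b z) * branch b z ∧
      branch a (branch b z) * branch b z ≤ 1 / 2 := fun z hz => by
    have ha : (0 : ℝ) ≤ a := a.cast_nonneg
    have hb : (0 : ℝ) ≤ b := b.cast_nonneg
    refine ⟨mul_nonneg (branch_mem_Icc a (branch_mem_Icc b hz)).1 (branch_mem_Icc b hz).1, ?_⟩
    have h : branch b z ≤ 1 := (branch_mem_Icc b hz).2
    have h' : 0 ≤ branch b z := (branch_mem_Icc b hz).1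
    rw [branch, inv_mul_eq_div, div_le_iff₀ (by linarith)]
    nlinarith [mul_nonneg ha h']
  rw [abs_branch_sub_branch a (branch_mem_Icc b hx).1 (branch_mem_Icc b hy).1,
    abs_branch_sub_branch b hx.1 hy.1]
  have h := mul_le_mul (key x hx).2 (key y hy).2 (key y hy).1 (by norm_num)
  nlinarith [mul_le_mul_of_nonneg_left h (abs_nonneg (x - y)), abs_nonneg (x - y)]

lemma abs_convergent_sub_le (j : ℕ) (x : ℕ → ℕ) {m n : ℕ} (hm : 2 * j ≤ m) (hn : 2 * j ≤ n) :
    |convergent x m - convergent x n| ≤ (1 / 2) ^ j := by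
  induction j generalizing x m n with
  | zero =>
    have h1 := convergent_mem_Icc x m
    have h2 := convergent_mem_Icc x n
    rw [pow_zero, abs_le]
    exact ⟨by linarith [h1.1, h2.2], by linarith [h1.2, h2.1]⟩
  | succ j ih =>
    obtain ⟨m, rfl⟩ := Nat.exists_eq_add_of_le' (show 2 ≤ m by omega)
    obtain ⟨n, rfl⟩ := Nat.exists_eq_add_of_le' (show 2 ≤ n by omega)
    simp only [convergent_succ]
    refine (abs_branch_branch_sub_le _ _ (convergent_mem_Icc _ _) (convergent_mem_Icc _ _)).trans ?_
    rw [pow_succ']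
    exact mul_le_mul_of_nonneg_left (ih _ (by omega) (by omega)) (by norm_num)

lemma tendsto_convergent (x : ℕ → ℕ) : Tendsto (convergent x) atTop (𝓝 (cfPi x)) := by
  have h : CauchySeq (convergent x) := by
    rw [Metric.cauchySeq_iff]
    intro ε hε
    obtain ⟨j, hj⟩ := exists_pow_lt_of_lt_one hε (by norm_num : (1 / 2 : ℝ) < 1)
    exact ⟨2 * j, fun m hm n hn => (abs_convergent_sub_le j x hm hn).trans_lt hj⟩
  exact h.tendsto_limUnder

lemma cfPi_mem_Icc (x : ℕ → ℕ) : cfPi x ∈ Icc (0 : ℝ) 1 :=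
  isClosed_Icc.mem_of_tendsto (tendsto_convergent x)
    (Eventually.of_forall fun n => convergent_mem_Icc x n)

lemma cfPi_eq_branch (x : ℕ → ℕ) : cfPi x = branch (x 0) (cfPi (fullShift x)) := by
  have h1 := (tendsto_add_atTop_iff_nat 1).2 (tendsto_convergent x)
  simp only [convergent_succ] at h1
  have h2 := (hasDerivAt_branch (x 0) (cfPi_mem_Icc (fullShift x)).1).continuousAt.tendsto.comp
    (tendsto_convergent (fullShift x))
  exact tendsto_nhds_unique h1 h2

lemma cfPi_mem_Ioo (x : ℕ → ℕ) : cfPi x ∈ Ioo (0 : ℝ) 1 := by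
  have hpos : ∀ z, 0 < cfPi z := fun z => by
    rw [cfPi_eq_branch]
    exact branch_pos _ (cfPi_mem_Icc _).1
  refine ⟨hpos x, ?_⟩
  rw [cfPi_eq_branch]
  exact branch_lt_one _ (hpos _)

lemma irrational_cfPi (x : ℕ → ℕ) : Irrational (cfPi x) := by
  have h : ∀ i, ∃ z, gaussMap^[i] (cfPi x) = cfPi z := fun i => by
    induction i with
    | zero => exact ⟨x, rfl⟩
    | succ i ih =>
      obtain ⟨z, hz⟩ := ih
      exact ⟨fullShift z, by
        rw [Function.iterate_succ_apply', hz, cfPi_eq_branch, gaussMap_branch _ (cfPi_mem_Ioo _)]⟩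
  refine irrational_of_forall_iterate_pos fun i => ?_
  obtain ⟨z, hz⟩ := h i
  rw [hz]
  exact (cfPi_mem_Ioo z).1

/-! ### Sums over preimages and periodic points -/

lemma tsum_preimages {k : ℕ} (hk : 1 ≤ k) (β : ℝ) (n : ℕ) {y : ℝ} (hy : y ∈ Ioo (0 : ℝ) 1)
    (hi : Irrational y) :
    ∑' x : {x : ℝ // x ∈ Ioo (0 : ℝ) 1 ∧ Irrational x ∧ gaussMap^[n] x = y},
      Real.exp (β * (digitCount k n (x : ℝ) : ℝ)) * |deriv (gaussMap^[n]) (x : ℝ)|⁻¹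
      = (partitionFn β k n y).toReal := by
  let e : (Fin n → ℕ) ≃ {x : ℝ // x ∈ Ioo (0 : ℝ) 1 ∧ Irrational x ∧ gaussMap^[n] x = y} :=
    { toFun := fun w => ⟨wordMap n w y, wordMap_mem_Ioo n w hy, irrational_wordMap n w hi,
        iterate_gaussMap_wordMap n w hy⟩
      invFun := fun x => digits n x
      left_inv := fun w => digits_wordMap n w hy
      right_inv := fun x => Subtype.ext (by
        have h := wordMap_digits x.2.1 x.2.2.1 n
        rwa [x.2.2.2] at h) }
  rw [← e.tsum_eq, partitionFn_eq_tsum, ENNReal.tsum_toReal_eq fun _ => ENNReal.ofReal_ne_top]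
  refine tsum_congr fun w => ?_
  rw [ENNReal.toReal_ofReal (wordWeight_nonneg β k n w y)]
  exact weight_wordMap hk β n w hy

lemma abs_wordMap_sub_le (n : ℕ) (w : Fin n → ℕ) {x y : ℝ} (hx : x ∈ Icc (0 : ℝ) 1)
    (hy : y ∈ Icc (0 : ℝ) 1) : |wordMap n w x - wordMap n w y| ≤ |x - y| := by
  induction n generalizing x y with
  | zero => exact le_rfl
  | succ n ih =>
    refine (ih (Fin.tail w) (branch_mem_Icc _ hx) (branch_mem_Icc _ hy)).trans ?_
    rw [abs_branch_sub_branch _ hx.1 hy.1]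
    exact mul_le_of_le_one_right (abs_nonneg _) (mul_le_one₀ (branch_mem_Icc _ hx).2
      (branch_mem_Icc _ hy).1 (branch_mem_Icc _ hy).2)

lemma wordMap_fixed_unique {n : ℕ} (hn : 1 ≤ n) (w : Fin n → ℕ) {x y : ℝ}
    (hx : x ∈ Ioo (0 : ℝ) 1) (hy : y ∈ Ioo (0 : ℝ) 1) (hfx : wordMap n w x = x)
    (hfy : wordMap n w y = y) : x = y := by
  obtain ⟨n, rfl⟩ := Nat.exists_eq_add_of_le' hn
  by_contra hne
  have h := abs_wordMap_sub_le n (Fin.tail w) (branch_mem_Icc (w 0) (Ioo_subset_Icc_self hx))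
    (branch_mem_Icc (w 0) (Ioo_subset_Icc_self hy))
  rw [wordMap] at hfx hfy
  rw [hfx, hfy, abs_branch_sub_branch _ hx.1.le hy.1.le] at h
  have h1 : branch (w 0) x * branch (w 0) y < 1 :=
    mul_lt_one_of_nonneg_of_lt_one_left (branch_mem_Ioo _ hx).1.le (branch_mem_Ioo _ hx).2
      (branch_mem_Ioo _ hy).2.le
  nlinarith [abs_pos.2 (sub_ne_zero.2 hne)]

lemma exists_wordMap_fixed {n : ℕ} (hn : 1 ≤ n) (w : Fin n → ℕ) :
    ∃ x ∈ Ioo (0 : ℝ) 1, wordMap n w x = x := by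
  obtain ⟨x, hx, hf⟩ := exists_mem_Icc_isFixedPt_of_mapsTo (continuousOn_wordMap n w)
    zero_le_one (fun y hy => wordMap_mem_Icc n w hy)
  refine ⟨x, ?_, hf⟩
  obtain ⟨n, rfl⟩ := Nat.exists_eq_add_of_le' hn
  have hf' : wordMap n (Fin.tail w) (branch (w 0) x) = x := hf
  have hpos : 0 < x := by
    rw [← hf']
    exact wordMap_pos _ _ (branch_pos _ hx.1)
  rw [← hf']
  exact wordMap_mem_Ioo _ _ ⟨branch_pos _ hx.1, branch_lt_one _ hpos⟩

lemma tsum_periodic {k : ℕ} (hk : 1 ≤ k) (β : ℝ) {n : ℕ} (hn : 1 ≤ n) :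
    ∃ z : (Fin n → ℕ) → ℝ, (∀ w, z w ∈ Icc (0 : ℝ) 1) ∧
    ∑' x : {x : ℝ // x ∈ Ioo (0 : ℝ) 1 ∧ Irrational x ∧ gaussMap^[n] x = x},
      Real.exp (β * (digitCount k n (x : ℝ) : ℝ)) * |deriv (gaussMap^[n]) (x : ℝ)|⁻¹
      = (∑' w, ENNReal.ofReal (wordWeight β k n w (z w))).toReal := by
  choose z hz hfix using exists_wordMap_fixed hn
  have hT : ∀ w, gaussMap^[n] (z w) = z w := fun w => by
    conv_lhs => rw [← hfix w]
    exact iterate_gaussMap_wordMap n w (hz w)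
  refine ⟨z, fun w => Ioo_subset_Icc_self (hz w), ?_⟩
  let e : (Fin n → ℕ) ≃ {x : ℝ // x ∈ Ioo (0 : ℝ) 1 ∧ Irrational x ∧ gaussMap^[n] x = x} :=
    { toFun := fun w => ⟨z w, hz w, irrational_of_periodic hn (hz w).1 (hT w), hT w⟩
      invFun := fun x => digits n x
      left_inv := fun w => by
        have h := digits_wordMap n w (hz w)
        rwa [hfix w] at h
      right_inv := fun x => Subtype.ext (by
        have h := wordMap_digits x.2.1 x.2.2.1 n
        rw [x.2.2.2] at h
        exact wordMap_fixed_unique hn _ (hz _) x.2.1 (hfix _) h) }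
  rw [← e.tsum_eq, ENNReal.tsum_toReal_eq fun _ => ENNReal.ofReal_ne_top]
  refine tsum_congr fun w => ?_
  rw [ENNReal.toReal_ofReal (wordWeight_nonneg β k n w _), ← weight_wordMap hk β n w (hz w), hfix]
  rfl

lemma tsum_wordWeight_le (β : ℝ) (k n : ℕ) {z : (Fin n → ℕ) → ℝ} (hz : ∀ w, z w ∈ Icc (0 : ℝ) 1) :
    ∑' w, ENNReal.ofReal (wordWeight β k n w (z w)) ≤ 4 * partitionFn β k n 0 ∧
    partitionFn β k n 0 ≤ 4 * ∑' w, ENNReal.ofReal (wordWeight β k n w (z w)) := by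
  have h0 : (0 : ℝ) ∈ Icc (0 : ℝ) 1 := by simp
  rw [partitionFn_eq_tsum, ← ENNReal.tsum_mul_left, ← ENNReal.tsum_mul_left]
  constructor <;> refine ENNReal.tsum_le_tsum fun w => ?_ <;>
    rw [show (4 : ℝ≥0∞) = ENNReal.ofReal 4 by norm_num, ← ENNReal.ofReal_mul (by norm_num)]
  · exact ENNReal.ofReal_le_ofReal (wordWeight_le_four_mul β k n w (hz w) h0)
  · exact ENNReal.ofReal_le_ofReal (wordWeight_le_four_mul β k n w h0 (hz w))

/-! ### Change of variables -/

lemma pairwise_disjoint_branch_image :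
    Pairwise (Function.onFun Disjoint fun a : ℕ => branch a '' Ioo (0 : ℝ) 1) := by
  intro a b hab
  rw [Function.onFun, Set.disjoint_left]
  rintro _ ⟨x, hx, rfl⟩ ⟨y, hy, hxy⟩
  apply hab
  rw [← digit_branch a hx, ← hxy, digit_branch b hy]

lemma iUnion_branch_image_ae_eq :
    (⋃ a : ℕ, branch a '' Ioo (0 : ℝ) 1) =ᵐ[volume] Ioo (0 : ℝ) 1 := by
  refine (ae_le_set.2 ?_).antisymm (ae_le_set.2 ?_)
  · rw [sdiff_eq_empty.2, measure_empty]
    refine iUnion_subset fun a => ?_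
    rintro _ ⟨x, hx, rfl⟩
    exact branch_mem_Ioo a hx
  · refine measure_mono_null (t := range ((↑) : ℚ → ℝ)) ?_ ((countable_range _).measure_zero _)
    rintro x ⟨hx, hx'⟩
    by_contra hirr
    exact hx' (mem_iUnion.2 ⟨digit x, gaussMap x, gaussMap_mem_Ioo hirr, branch_digit hx⟩)

lemma setLIntegral_eq_transfer {f : ℝ → ℝ≥0∞} (hf : Measurable f) (k : ℕ) :
    ∫⁻ x in Ioo (0 : ℝ) 1, f x = ∫⁻ y in Ioo (0 : ℝ) 1, transfer 0 k f y := by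
  have hinj : ∀ a, InjOn (branch a) (Ioo (0 : ℝ) 1) := fun a x hx y hy hxy => by
    rw [← gaussMap_branch a hx, hxy, gaussMap_branch a hy]
  have hder : ∀ a, ∀ x ∈ Ioo (0 : ℝ) 1,
      HasDerivWithinAt (branch a) (-(branch a x ^ 2)) (Ioo 0 1) x := fun a x hx =>
    (hasDerivAt_branch a hx.1.le).hasDerivWithinAt
  rw [← setLIntegral_congr iUnion_branch_image_ae_eq, lintegral_iUnion
    (fun a => measurableSet_Ioo.image_of_measurable_injOn (measurable_branch a) (hinj a))
    pairwise_disjoint_branch_image]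
  simp only [transfer]
  have hm : ∀ a, Measurable fun y =>
      ENNReal.ofReal (Real.exp (0 * digitInd k a) * branch a y ^ 2) * f (branch a y) := fun a =>
    ((((measurable_branch a).pow_const 2).const_mul _).ennreal_ofReal).mul
      (hf.comp (measurable_branch a))
  rw [lintegral_tsum fun a => (hm a).aemeasurable]
  refine tsum_congr fun a => ?_
  rw [lintegral_image_eq_lintegral_abs_deriv_mul measurableSet_Ioo (hder a) (hinj a)]
  simp

lemma measurable_transfer {f : ℝ → ℝ≥0∞} (hf : Measurable f) (β : ℝ) (k : ℕ) :
    Measurable (transfer β k f) := by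
  unfold transfer
  exact Measurable.tsum fun a =>
    ((((measurable_branch a).pow_const 2).const_mul _).ennreal_ofReal).mul
    (hf.comp (measurable_branch a))

lemma setLIntegral_exp_digitCount {k : ℕ} (hk : 1 ≤ k) (β : ℝ) (n : ℕ) {g : ℝ → ℝ≥0∞}
    (hg : Measurable g) :
    ∫⁻ x in Ioo (0 : ℝ) 1, ENNReal.ofReal (Real.exp (β * (digitCount k n x : ℝ))) * g x =
      ∫⁻ y in Ioo (0 : ℝ) 1, (transfer β k)^[n] g y := by
  induction n generalizing g with
  | zero => simp [digitCount_zero]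
  | succ n ih =>
    have hm : ∀ n, Measurable fun x : ℝ =>
        ENNReal.ofReal (Real.exp (β * (digitCount k n x : ℝ))) := fun n =>
      (Real.measurable_exp.comp ((measurable_from_top.comp
        (measurable_digitCount k n)).const_mul β)).ennreal_ofReal
    rw [Function.iterate_succ_apply, ← ih (measurable_transfer hg β k)]
    refine (setLIntegral_eq_transfer ((hm (n + 1)).mul hg) k).trans ?_
    refine setLIntegral_congr_fun measurableSet_Ioo fun y hy => ?_
    simp only [transfer, ← ENNReal.tsum_mul_left]
    refine tsum_congr fun a => ?_
    rw [Pi.mul_apply, digitCount_succ_branch hk n a hy, mul_add, Real.exp_add, ← mul_assoc,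
      ← mul_assoc,
      ← ENNReal.ofReal_mul (by positivity), ← ENNReal.ofReal_mul (by positivity)]
    congr 2
    rw [zero_mul, Real.exp_zero]
    ring

lemma integral_exp_digitCount {k : ℕ} (hk : 1 ≤ k) (β : ℝ) (n : ℕ) :
    ∫ x in Ioo (0 : ℝ) 1, Real.exp (β * (digitCount k n x : ℝ)) =
      (∫⁻ y in Ioo (0 : ℝ) 1, partitionFn β k n y).toReal := by
  have hm : Measurable fun x : ℝ => Real.exp (β * (digitCount k n x : ℝ)) :=
    Real.measurable_exp.comp ((measurable_from_top.comp (measurable_digitCount k n)).const_mul β)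
  rw [integral_eq_lintegral_of_nonneg_ae (Eventually.of_forall fun x => (Real.exp_pos _).le)
    hm.aestronglyMeasurable, partitionFn, ← setLIntegral_exp_digitCount hk β n measurable_const]
  simp

lemma setLIntegral_partitionFn_le (β : ℝ) (k n : ℕ) :
    ∫⁻ y in Ioo (0 : ℝ) 1, partitionFn β k n y ≤ 4 * partitionFn β k n 0 ∧
    partitionFn β k n 0 ≤ 4 * ∫⁻ y in Ioo (0 : ℝ) 1, partitionFn β k n y := by
  have h0 : (0 : ℝ) ∈ Icc (0 : ℝ) 1 := by simp
  have hc : ∀ c : ℝ≥0∞, ∫⁻ _ in Ioo (0 : ℝ) 1, c = c := fun c => by simp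
  constructor
  · rw [← hc (4 * partitionFn β k n 0)]
    exact setLIntegral_mono measurable_const fun y hy =>
      partitionFn_le_four_mul β k n (Ioo_subset_Icc_self hy) h0
  · rw [← hc (partitionFn β k n 0), ← lintegral_const_mul' _ _ (by norm_num)]
    exact setLIntegral_mono' measurableSet_Ioo fun y hy =>
      partitionFn_le_four_mul β k n h0 (Ioo_subset_Icc_self hy)

/-! ### The normalized transfer operator -/

/-- The transition probabilities of the transfer operator normalized by the Gauss density. -/
noncomputable def branchProb (a : ℕ) (x : ℝ) : ℝ :=
  (1 + x) / (((a : ℝ) + 1 + x) * ((a : ℝ) + 2 + x))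

/-- The transfer operator normalized by the Gauss density. -/
noncomputable def average (f : ℝ → ℝ) (x : ℝ) : ℝ := ∑' a : ℕ, branchProb a x * f (branch a x)

lemma branchProb_nonneg (a : ℕ) {x : ℝ} (hx : 0 ≤ x) : 0 ≤ branchProb a x := by
  unfold branchProb; positivity

lemma hasSum_branchProb {x : ℝ} (hx : 0 ≤ x) : HasSum (fun a => branchProb a x) 1 := by
  rw [hasSum_iff_tendsto_nat_of_nonneg fun a => branchProb_nonneg a hx]
  have hs : ∀ n : ℕ, ∑ a ∈ Finset.range n, branchProb a x = 1 - (1 + x) / (n + (1 + x)) := by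
    intro n
    induction n with
    | zero =>
      have : 1 + x ≠ 0 := by positivity
      simp [this]
    | succ n ih =>
      rw [Finset.sum_range_succ, ih, branchProb]
      have h1 : (n : ℝ) + (1 + x) ≠ 0 := by positivity
      have h2 : (n : ℝ) + 1 + x ≠ 0 := by positivity
      have h3 : (n : ℝ) + 2 + x ≠ 0 := by positivity
      have h4 : (n : ℝ) + 1 + (1 + x) ≠ 0 := by positivity
      push_cast
      field_simp
      ring
  simp only [hs]
  have h : Tendsto (fun n : ℕ => (1 + x) / ((n : ℝ) + (1 + x))) atTop (𝓝 0) :=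
    tendsto_const_nhds.div_atTop (tendsto_atTop_add_const_right _ _ tendsto_natCast_atTop_atTop)
  simpa using h.const_sub 1

lemma summable_branchProb_mul {x : ℝ} (hx : 0 ≤ x) {g : ℕ → ℝ} {M : ℝ} (hg : ∀ a, |g a| ≤ M) :
    Summable fun a => branchProb a x * g a := by
  refine Summable.of_norm_bounded ((hasSum_branchProb hx).summable.mul_right M) fun a => ?_
  rw [Real.norm_eq_abs, abs_mul, abs_of_nonneg (branchProb_nonneg a hx)]
  exact mul_le_mul_of_nonneg_left (hg a) (branchProb_nonneg a hx)

lemma hasSum_average {f : ℝ → ℝ} {M : ℝ} (hf : ∀ y ∈ Icc (0 : ℝ) 1, |f y| ≤ M) {x : ℝ}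
    (hx : x ∈ Icc (0 : ℝ) 1) : HasSum (fun a => branchProb a x * f (branch a x)) (average f x) :=
  (summable_branchProb_mul hx.1 fun a => hf _ (branch_mem_Icc a hx)).hasSum

lemma average_mem_Icc {f : ℝ → ℝ} {l u : ℝ} (hf : ∀ y ∈ Icc (0 : ℝ) 1, f y ∈ Icc l u) :
    ∀ x ∈ Icc (0 : ℝ) 1, average f x ∈ Icc l u := by
  intro x hx
  have h := hasSum_average (M := max |l| |u|)
    (fun y hy => abs_le_max_abs_abs (hf y hy).1 (hf y hy).2) hx
  have hc : ∀ c, HasSum (fun a => branchProb a x * c) c := fun c => by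
    simpa using (hasSum_branchProb hx.1).mul_right c
  exact ⟨hasSum_le (fun a => mul_le_mul_of_nonneg_left (hf _ (branch_mem_Icc a hx)).1
      (branchProb_nonneg a hx.1)) (hc l) h,
    hasSum_le (fun a => mul_le_mul_of_nonneg_left (hf _ (branch_mem_Icc a hx)).2
      (branchProb_nonneg a hx.1)) h (hc u)⟩

lemma average_neg (f : ℝ → ℝ) : average (fun y => -f y) = fun y => -average f y := by
  funext y
  simp [average, tsum_neg]

lemma branchProb_sub_mul_nonneg {x y : ℝ} (hx : x ∈ Icc (0 : ℝ) 1) (hy : y ∈ Icc (0 : ℝ) 1)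
    (hxy : x ≤ y) {g : ℕ → ℝ} (hg : Antitone g) (a : ℕ) :
    0 ≤ (branchProb a x - branchProb a y) * (g a - g 1) := by
  have key : branchProb a x - branchProb a y = (y - x) *
      (x + y + x * y + 1 + ((a : ℝ) + 1) - ((a : ℝ) + 1) ^ 2) /
      ((((a : ℝ) + 1 + x) * ((a : ℝ) + 2 + x)) * (((a : ℝ) + 1 + y) * ((a : ℝ) + 2 + y))) := by
    have hx0 := hx.1
    have hy0 := hy.1
    have h1 : (a : ℝ) + 1 + x ≠ 0 := by positivity
    have h2 : (a : ℝ) + 2 + x ≠ 0 := by positivity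
    have h3 : (a : ℝ) + 1 + y ≠ 0 := by positivity
    have h4 : (a : ℝ) + 2 + y ≠ 0 := by positivity
    unfold branchProb
    field_simp
    ring
  have hden : 0 ≤ (((a : ℝ) + 1 + x) * ((a : ℝ) + 2 + x)) *
      (((a : ℝ) + 1 + y) * ((a : ℝ) + 2 + y)) := by
    have hx0 := hx.1
    have hy0 := hy.1
    positivity
  have hxy' : x * y ≤ 1 := mul_le_one₀ hx.2 hy.1 hy.2
  rw [key]
  match a with
  | 0 =>
    refine mul_nonneg (div_nonneg (mul_nonneg (by linarith) ?_) hden)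
      (sub_nonneg.2 (hg zero_le_one))
    push_cast
    nlinarith [mul_nonneg hx.1 hy.1, hx.1, hy.1]
  | 1 => simp
  | a + 2 =>
    refine mul_nonneg_of_nonpos_of_nonpos (div_nonpos_of_nonpos_of_nonneg
      (mul_nonpos_of_nonneg_of_nonpos (by linarith) ?_) hden) (sub_nonpos.2 (hg (by omega)))
    have ha : (0 : ℝ) ≤ a := a.cast_nonneg
    push_cast
    nlinarith [hx.2, hy.2]

lemma average_antitoneOn {f : ℝ → ℝ} (hf : MonotoneOn f (Icc 0 1)) :
    AntitoneOn (average f) (Icc 0 1) := by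
  intro x hx y hy hxy
  have h0 : (0 : ℝ) ∈ Icc (0 : ℝ) 1 := by simp
  have h1 : (1 : ℝ) ∈ Icc (0 : ℝ) 1 := by simp
  have hM : ∀ y ∈ Icc (0 : ℝ) 1, |f y| ≤ max |f 0| |f 1| := fun y hy =>
    abs_le_max_abs_abs (hf h0 hy hy.1) (hf hy h1 hy.2)
  have hg : Antitone fun a => f (branch a x) := fun a b hab =>
    hf (branch_mem_Icc b hx) (branch_mem_Icc a hx) (branch_antitone_digit hab hx.1)
  have hs := ((hasSum_average hM hx).sub (hasSum_average hM hy)).sub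
    (((hasSum_branchProb hx.1).sub (hasSum_branchProb hy.1)).mul_right (f (branch 1 x)))
  rw [sub_self, zero_mul, sub_zero] at hs
  refine sub_nonneg.1 (hs.nonneg fun a => ?_)
  have e1 := branchProb_sub_mul_nonneg hx hy hxy hg a
  have e2 : 0 ≤ branchProb a y * (f (branch a x) - f (branch a y)) :=
    mul_nonneg (branchProb_nonneg a hy.1) (sub_nonneg.2
      (hf (branch_mem_Icc a hy) (branch_mem_Icc a hx) (branch_antitone a hx.1 hxy)))
  calc (0 : ℝ) ≤ _ := add_nonneg e1 e2
    _ = _ := by ring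

lemma average_monotoneOn {f : ℝ → ℝ} (hf : AntitoneOn f (Icc 0 1)) :
    MonotoneOn (average f) (Icc 0 1) := by
  have h := average_antitoneOn hf.neg
  intro x hx y hy hxy
  have h' := h hx hy hxy
  rw [average_neg] at h'
  exact neg_le_neg_iff.1 h'

lemma average_zero_eq {f : ℝ → ℝ} {M : ℝ} (hf : ∀ y ∈ Icc (0 : ℝ) 1, |f y| ≤ M) :
    average f 0 = 1 / 2 * f 1 + 1 / 2 * average f 1 := by
  have h0 : (0 : ℝ) ∈ Icc (0 : ℝ) 1 := by simp
  rw [average, (hasSum_average hf h0).summable.tsum_eq_zero_add, average, ← tsum_mul_left]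
  congr 1
  · norm_num [branchProb, branch]
  · refine tsum_congr fun a => ?_
    have hb : branch (a + 1) 0 = branch a 1 := by
      unfold branch; push_cast; ring
    have hp : branchProb (a + 1) 0 = 1 / 2 * branchProb a 1 := by
      unfold branchProb
      push_cast
      have : (a : ℝ) + 1 + 1 ≠ 0 := by positivity
      have : (a : ℝ) + 2 + 1 ≠ 0 := by positivity
      have : (a : ℝ) + 1 + 1 + 0 ≠ 0 := by positivity
      have : (a : ℝ) + 1 + 2 + 0 ≠ 0 := by positivity
      field_simp
      ring
    rw [hb, hp, mul_assoc]

/-- `f` is monotone on the unit interval, in one direction or the other, with oscillation at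
most `d`. -/
def MonotoneWithOsc (f : ℝ → ℝ) (d : ℝ) : Prop :=
  (MonotoneOn f (Icc 0 1) ∨ AntitoneOn f (Icc 0 1)) ∧ |f 1 - f 0| ≤ d

lemma MonotoneWithOsc.abs_sub_le {f : ℝ → ℝ} {d : ℝ} (hf : MonotoneWithOsc f d) {x y : ℝ}
    (hx : x ∈ Icc (0 : ℝ) 1) (hy : y ∈ Icc (0 : ℝ) 1) : |f x - f y| ≤ d := by
  have h0 : (0 : ℝ) ∈ Icc (0 : ℝ) 1 := by simp
  have h1 : (1 : ℝ) ∈ Icc (0 : ℝ) 1 := by simp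
  obtain ⟨hm, hd⟩ := hf
  rw [_root_.abs_le] at hd ⊢
  rcases hm with hm | hm
  · have e1 := hm h0 hx hx.1
    have e2 := hm h0 hy hy.1
    have e3 := hm hx h1 hx.2
    have e4 := hm hy h1 hy.2
    exact ⟨by linarith, by linarith⟩
  · have e1 := hm h0 hx hx.1
    have e2 := hm h0 hy hy.1
    have e3 := hm hx h1 hx.2
    have e4 := hm hy h1 hy.2
    exact ⟨by linarith, by linarith⟩

/-- The normalized transfer operator halves the oscillation of monotone functions. -/
lemma MonotoneWithOsc.average {f : ℝ → ℝ} {d : ℝ} (hf : MonotoneWithOsc f d) :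
    MonotoneWithOsc (average f) (1 / 2 * d) := by
  have h1 : (1 : ℝ) ∈ Icc (0 : ℝ) 1 := by simp
  refine ⟨hf.1.symm.imp average_monotoneOn average_antitoneOn, ?_⟩
  have hmem : ∀ y ∈ Icc (0 : ℝ) 1, f y ∈ Icc (f 1 - d) (f 1 + d) := fun y hy => by
    have := _root_.abs_le.1 (hf.abs_sub_le hy h1)
    exact ⟨by linarith, by linarith⟩
  have h := average_mem_Icc hmem 1 h1
  rw [average_zero_eq fun y hy => abs_le_max_abs_abs (hmem y hy).1 (hmem y hy).2, _root_.abs_le]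
  exact ⟨by linarith [h.1, h.2], by linarith [h.1, h.2]⟩

lemma MonotoneWithOsc.iterate_average {f : ℝ → ℝ} {d : ℝ} (hf : MonotoneWithOsc f d) (N : ℕ) :
    MonotoneWithOsc (GaussFreeEnergy.average^[N] f) ((1 / 2) ^ N * d) := by
  induction N with
  | zero => simpa using hf
  | succ N ih =>
    rw [Function.iterate_succ_apply', pow_succ', mul_assoc]
    exact ih.average

lemma iterate_average_mem_Icc {f : ℝ → ℝ} {l u : ℝ} (hf : ∀ y ∈ Icc (0 : ℝ) 1, f y ∈ Icc l u)
    (N : ℕ) : ∀ x ∈ Icc (0 : ℝ) 1, average^[N] f x ∈ Icc l u := by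
  induction N with
  | zero => exact hf
  | succ N ih =>
    rw [Function.iterate_succ_apply']
    exact average_mem_Icc ih

/-- The transfer operator conjugated by the Gauss density. -/
lemma transfer_density_mul (β : ℝ) (k : ℕ) {f : ℝ → ℝ} {M : ℝ}
    (hf : ∀ y ∈ Icc (0 : ℝ) 1, f y ∈ Icc 0 M) {y : ℝ} (hy : y ∈ Icc (0 : ℝ) 1) :
    transfer β k (fun z => ENNReal.ofReal ((1 + z)⁻¹ * f z)) y =
      ENNReal.ofReal ((1 + y)⁻¹ *
        ∑' a, branchProb a y * (Real.exp (β * digitInd k a) * f (branch a y))) := by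
  have hy0 := hy.1
  have hbd : ∀ a, |Real.exp (β * digitInd k a) * f (branch a y)| ≤ Real.exp |β| * M := fun a => by
    have h := hf _ (branch_mem_Icc a hy)
    rw [abs_of_nonneg (mul_nonneg (Real.exp_pos _).le h.1)]
    refine mul_le_mul (Real.exp_le_exp.2 ?_) h.2 h.1 (Real.exp_pos _).le
    refine (le_abs_self _).trans ?_
    rw [abs_mul, abs_of_nonneg (digitInd_nonneg k a)]
    exact mul_le_of_le_one_right (abs_nonneg _) (digitInd_le_one k a)
  rw [← tsum_mul_left, ENNReal.ofReal_tsum_of_nonneg _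
    ((summable_branchProb_mul hy0 hbd).mul_left _), transfer]
  · refine tsum_congr fun a => ?_
    rw [← ENNReal.ofReal_mul (by positivity)]
    congr 1
    have e : branch a y ^ 2 * (1 + branch a y)⁻¹ = (1 + y)⁻¹ * branchProb a y := by
      unfold branch branchProb
      have : (a : ℝ) + 1 + y ≠ 0 := by positivity
      have : (a : ℝ) + 2 + y ≠ 0 := by positivity
      have : 1 + y ≠ 0 := by positivity
      have : 1 + ((a : ℝ) + 1 + y)⁻¹ ≠ 0 := by positivity
      field_simp
      ring
    linear_combination (Real.exp (β * digitInd k a) * f (branch a y)) * e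
  · intro a
    have := branchProb_nonneg a hy0
    have := (hf _ (branch_mem_Icc a hy)).1
    positivity

lemma iterate_transfer_density_mul (k : ℕ) {f : ℝ → ℝ} {M : ℝ}
    (hf : ∀ y ∈ Icc (0 : ℝ) 1, f y ∈ Icc 0 M) (N : ℕ) :
    ∀ y ∈ Icc (0 : ℝ) 1, (transfer 0 k)^[N] (fun z => ENNReal.ofReal ((1 + z)⁻¹ * f z)) y =
      ENNReal.ofReal ((1 + y)⁻¹ * average^[N] f y) := by
  induction N with
  | zero => intro y _; rfl
  | succ N ih =>
    intro y hy
    have h : transfer 0 k ((transfer 0 k)^[N] fun z => ENNReal.ofReal ((1 + z)⁻¹ * f z)) y =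
        transfer 0 k (fun z => ENNReal.ofReal ((1 + z)⁻¹ * average^[N] f z)) y :=
      (transfer_mono (fun z hz => (ih z hz).le) y hy).antisymm
        (transfer_mono (fun z hz => (ih z hz).ge) y hy)
    rw [Function.iterate_succ_apply', Function.iterate_succ_apply', h,
      transfer_density_mul 0 k (iterate_average_mem_Icc hf N) hy]
    simp [average]

/-! ### Convergence of the digit frequencies -/

/-- The conditional probability, given the future, of a digit being at least `k`. -/
noncomputable def tailProb (k : ℕ) (x : ℝ) : ℝ := (1 + x) / (k + x)

lemma tailProb_mem_Icc {k : ℕ} (hk : 1 ≤ k) :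
    ∀ x ∈ Icc (0 : ℝ) 1, tailProb k x ∈ Icc (0 : ℝ) 1 := by
  intro x hx
  have hk' : (1 : ℝ) ≤ k := by exact_mod_cast hk
  have hx0 := hx.1
  unfold tailProb
  exact ⟨by positivity, (div_le_one (by linarith)).2 (by linarith)⟩

lemma monotoneWithOsc_tailProb {k : ℕ} (hk : 1 ≤ k) : MonotoneWithOsc (tailProb k) 1 := by
  have hk' : (1 : ℝ) ≤ k := by exact_mod_cast hk
  refine ⟨Or.inl fun x hx y hy hxy => ?_, ?_⟩
  · unfold tailProb
    rw [div_le_div_iff₀ (by linarith [hx.1]) (by linarith [hy.1])]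
    nlinarith
  · have h0 := tailProb_mem_Icc hk 0 (by simp)
    have h1 := tailProb_mem_Icc hk 1 (by simp)
    rw [_root_.abs_le]
    exact ⟨by linarith [h0.2, h1.1], by linarith [h0.1, h1.2]⟩

lemma setLIntegral_inv_add {c : ℝ} (hc : 1 ≤ c) :
    ∫⁻ x in Ioo (0 : ℝ) 1, ENNReal.ofReal ((c + x)⁻¹) =
      ENNReal.ofReal (Real.log ((c + 1) / c)) := by
  have hi : IntervalIntegrable (fun x : ℝ => (c + x)⁻¹) volume 0 1 := by
    refine ContinuousOn.intervalIntegrable ?_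
    rw [uIcc_of_le zero_le_one]
    exact ContinuousOn.inv₀ (by fun_prop) fun x hx => by linarith [hx.1]
  have hi' : IntegrableOn (fun x : ℝ => (c + x)⁻¹) (Ioo 0 1) :=
    ((intervalIntegrable_iff_integrableOn_Ioc_of_le zero_le_one).1 hi).mono_set Ioo_subset_Ioc_self
  rw [← ofReal_integral_eq_lintegral_ofReal hi', ← integral_Ioc_eq_integral_Ioo,
    ← intervalIntegral.integral_of_le zero_le_one,
    intervalIntegral.integral_comp_add_left (fun x : ℝ => x⁻¹),
    integral_inv_of_pos (by linarith) (by linarith), add_zero]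
  filter_upwards [ae_restrict_mem measurableSet_Ioo] with x hx
  have := hx.1
  simp only [Pi.zero_apply]
  positivity

lemma abs_iterate_average_tailProb_sub_le {k : ℕ} (hk : 1 ≤ k) (N : ℕ) {x : ℝ}
    (hx : x ∈ Icc (0 : ℝ) 1) :
    |average^[N] (tailProb k) x - Real.log (((k : ℝ) + 1) / k) / Real.log 2| ≤ (1 / 2) ^ N := by
  have hk' : (1 : ℝ) ≤ k := by exact_mod_cast hk
  set f := average^[N] (tailProb k) with hf
  set m := Real.log (((k : ℝ) + 1) / k) with hm
  set d : ℝ := (1 / 2) ^ N with hd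
  have hd0 : 0 ≤ d := by positivity
  have hm0 : 0 ≤ m := Real.log_nonneg ((one_le_div (by linarith)).2 (by linarith))
  have hlog : 0 < Real.log 2 := Real.log_pos (by norm_num)
  have hosc : ∀ y ∈ Icc (0 : ℝ) 1, |f y - f x| ≤ d := fun y hy =>
    (((monotoneWithOsc_tailProb hk).iterate_average N).abs_sub_le hy hx).trans_eq (mul_one _)
  have hfx := iterate_average_mem_Icc (tailProb_mem_Icc hk) N x hx
  have hint : ∫⁻ y in Ioo (0 : ℝ) 1, ENNReal.ofReal ((1 + y)⁻¹ * f y) = ENNReal.ofReal m := by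
    have hmeas : Measurable fun y : ℝ => ENNReal.ofReal ((1 + y)⁻¹ * tailProb k y) := by
      unfold tailProb; fun_prop
    have h := setLIntegral_exp_digitCount hk 0 N hmeas
    rw [hm, ← setLIntegral_inv_add hk']
    refine ((setLIntegral_congr_fun measurableSet_Ioo fun y hy => ?_).trans h.symm).trans
      (setLIntegral_congr_fun measurableSet_Ioo fun y hy => ?_)
    · exact (iterate_transfer_density_mul k (tailProb_mem_Icc hk) N y (Ioo_subset_Icc_self hy)).symm
    · simp only [zero_mul, Real.exp_zero, ENNReal.ofReal_one, one_mul, tailProb]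
      have := hy.1
      congr 1
      field_simp
  have hconst : ∀ c : ℝ, ∫⁻ y in Ioo (0 : ℝ) 1, ENNReal.ofReal ((1 + y)⁻¹ * c) =
      ENNReal.ofReal (Real.log 2 * c) := fun c => by
    rw [setLIntegral_congr_fun (g := fun y => ENNReal.ofReal (1 + y)⁻¹ * ENNReal.ofReal c)
      measurableSet_Ioo fun y hy => ENNReal.ofReal_mul (by have := hy.1; positivity),
      lintegral_mul_const' _ _ ENNReal.ofReal_ne_top, setLIntegral_inv_add le_rfl,
      ← ENNReal.ofReal_mul (by norm_num; positivity)]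
    norm_num
  have hup : ENNReal.ofReal m ≤ ENNReal.ofReal (Real.log 2 * (f x + d)) := by
    rw [← hint, ← hconst]
    refine setLIntegral_mono' measurableSet_Ioo fun y hy => ENNReal.ofReal_le_ofReal ?_
    have := hy.1
    refine mul_le_mul_of_nonneg_left ?_ (by positivity)
    linarith [(_root_.abs_le.1 (hosc y (Ioo_subset_Icc_self hy))).2]
  have hlow : ENNReal.ofReal (Real.log 2 * (f x - d)) ≤ ENNReal.ofReal m := by
    rw [← hint, ← hconst]
    refine setLIntegral_mono' measurableSet_Ioo fun y hy => ENNReal.ofReal_le_ofReal ?_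
    have := hy.1
    refine mul_le_mul_of_nonneg_left ?_ (by positivity)
    linarith [(_root_.abs_le.1 (hosc y (Ioo_subset_Icc_self hy))).1]
  have hup' := (ENNReal.ofReal_le_ofReal_iff (mul_nonneg hlog.le (add_nonneg hfx.1 hd0))).1 hup
  have hlow' := (ENNReal.ofReal_le_ofReal_iff hm0).1 hlow
  have e1 : m / Real.log 2 ≤ f x + d := (div_le_iff₀' hlog).2 hup'
  have e2 : f x - d ≤ m / Real.log 2 := (le_div_iff₀' hlog).2 hlow'
  rw [_root_.abs_le]
  exact ⟨by linarith, by linarith⟩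

/-! ### The corrector -/

/-- The conditional probability, given the `j`-th iterate of the normalized transfer operator, of
a digit being equal to `k`. -/
noncomputable def digitProb (k j : ℕ) (x : ℝ) : ℝ :=
  average^[j] (tailProb k) x - average^[j] (tailProb (k + 1)) x

/-- The frequency of the digit `k` under the Gauss measure. -/
noncomputable def digitFreq (k : ℕ) : ℝ :=
  Real.log (((k : ℝ) + 1) ^ 2 / ((k : ℝ) * ((k : ℝ) + 2))) / Real.log 2

/-- An approximate solution of the cohomological equation for the digit indicator. -/
noncomputable def corrector (k N : ℕ) (x : ℝ) : ℝ := ∑ j ∈ Finset.range N, digitProb k j x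

lemma abs_digitProb_le {k : ℕ} (hk : 1 ≤ k) (j : ℕ) :
    ∀ x ∈ Icc (0 : ℝ) 1, |digitProb k j x| ≤ 1 := by
  intro x hx
  have h1 := iterate_average_mem_Icc (tailProb_mem_Icc hk) j x hx
  have h2 := iterate_average_mem_Icc (tailProb_mem_Icc (Nat.le_add_left 1 k)) j x hx
  unfold digitProb
  rw [_root_.abs_le]
  exact ⟨by linarith [h1.1, h2.2], by linarith [h1.2, h2.1]⟩

lemma abs_digitProb_sub_digitFreq_le {k : ℕ} (hk : 1 ≤ k) (N : ℕ) {x : ℝ}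
    (hx : x ∈ Icc (0 : ℝ) 1) : |digitProb k N x - digitFreq k| ≤ 2 * (1 / 2) ^ N := by
  have h1 := abs_iterate_average_tailProb_sub_le hk N hx
  have h2 := abs_iterate_average_tailProb_sub_le (Nat.le_add_left 1 k) N hx
  have hk' : (0 : ℝ) < k := by exact_mod_cast hk
  have hlog : Real.log (((k : ℝ) + 1) ^ 2 / ((k : ℝ) * ((k : ℝ) + 2))) =
      Real.log (((k : ℝ) + 1) / k) - Real.log ((((k + 1 : ℕ) : ℝ) + 1) / (k + 1 : ℕ)) := by
    push_cast
    rw [← Real.log_div (by positivity) (by positivity)]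
    congr 1
    field_simp
    ring
  unfold digitProb digitFreq
  rw [hlog, sub_div]
  refine le_trans ?_ ((add_le_add h1 h2).trans_eq (two_mul _).symm)
  refine le_trans (le_of_eq ?_) (abs_sub _ _)
  congr 1
  ring

lemma hasSum_branchProb_mul_digitProb {k : ℕ} (hk : 1 ≤ k) (j : ℕ) {x : ℝ}
    (hx : x ∈ Icc (0 : ℝ) 1) :
    HasSum (fun a => branchProb a x * digitProb k j (branch a x)) (digitProb k (j + 1) x) := by
  have h : ∀ {k : ℕ}, 1 ≤ k →
      HasSum (fun a => branchProb a x * average^[j] (tailProb k) (branch a x))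
        (average^[j + 1] (tailProb k) x) := fun {k} hk => by
    rw [Function.iterate_succ_apply']
    refine hasSum_average (M := 1) (fun y hy => ?_) hx
    have := iterate_average_mem_Icc (tailProb_mem_Icc hk) j y hy
    exact abs_le.2 ⟨by linarith [this.1], this.2⟩
  simpa only [digitProb, mul_sub] using (h hk).sub (h (Nat.le_add_left 1 k))

lemma hasSum_branchProb_mul_digitInd {k : ℕ} (hk : 1 ≤ k) {x : ℝ} (hx : x ∈ Icc (0 : ℝ) 1) :
    HasSum (fun a => branchProb a x * digitInd k a) (digitProb k 0 x) := by
  obtain ⟨k, rfl⟩ : ∃ l, k = l + 1 := ⟨k - 1, by omega⟩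
  have hx0 := hx.1
  have h := hasSum_single (f := fun a => branchProb a x * digitInd (k + 1) a) k fun a ha => by
    simp [digitInd, ha]
  convert h using 1
  simp only [digitProb, Function.iterate_zero, id, tailProb, digitInd, branchProb, if_true, mul_one]
  push_cast
  have h1 : (k : ℝ) + 1 + x ≠ 0 := by positivity
  have h2 : (k : ℝ) + 2 + x ≠ 0 := by positivity
  have h3 : (k : ℝ) + 1 + 1 + x ≠ 0 := by positivity
  field_simp
  ring

lemma abs_corrector_le {k : ℕ} (hk : 1 ≤ k) (N : ℕ) :
    ∀ x ∈ Icc (0 : ℝ) 1, |corrector k N x| ≤ N := by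
  intro x hx
  refine (Finset.abs_sum_le_sum_abs _ _).trans ?_
  refine (Finset.sum_le_card_nsmul _ _ 1 fun j _ => abs_digitProb_le hk j x hx).trans ?_
  simp

/-- The digit indicator, centred and corrected by a coboundary. -/
noncomputable def centredInd (k N : ℕ) (x : ℝ) (a : ℕ) : ℝ :=
  digitInd k a + corrector k N (branch a x) - corrector k N x - digitFreq k

lemma hasSum_branchProb_mul_centredInd {k : ℕ} (hk : 1 ≤ k) (N : ℕ) {x : ℝ}
    (hx : x ∈ Icc (0 : ℝ) 1) :
    HasSum (fun a => branchProb a x * centredInd k N x a) (digitProb k N x - digitFreq k) := by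
  have h1 := hasSum_branchProb_mul_digitInd hk hx
  have h2 := hasSum_sum fun j (_ : j ∈ Finset.range N) => hasSum_branchProb_mul_digitProb hk j hx
  have h3 := (hasSum_branchProb hx.1).mul_right (corrector k N x + digitFreq k)
  have htel := Finset.sum_range_sub (fun j => digitProb k j x) N
  rw [Finset.sum_sub_distrib] at htel
  have hval : digitProb k N x - digitFreq k = digitProb k 0 x +
      ∑ j ∈ Finset.range N, digitProb k (j + 1) x - 1 * (corrector k N x + digitFreq k) := by
    unfold corrector
    linarith
  have hfun : (fun a => branchProb a x * centredInd k N x a) = fun a =>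
      branchProb a x * digitInd k a +
        ∑ j ∈ Finset.range N, branchProb a x * digitProb k j (branch a x) -
          branchProb a x * (corrector k N x + digitFreq k) := by
    funext a
    rw [← Finset.mul_sum, centredInd, corrector, corrector]
    ring
  rw [hval, hfun]
  exact (h1.add h2).sub h3

lemma abs_centredInd_le {k : ℕ} (hk : 1 ≤ k) (N : ℕ) {x : ℝ} (hx : x ∈ Icc (0 : ℝ) 1) (a : ℕ) :
    |centredInd k N x a| ≤ 2 * N + 1 + |digitFreq k| := by
  have h1 := abs_le.1 (abs_corrector_le hk N x hx)
  have h2 := abs_le.1 (abs_corrector_le hk N _ (branch_mem_Icc a hx))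
  have h3 := digitInd_nonneg k a
  have h4 := digitInd_le_one k a
  have h5 := neg_abs_le (digitFreq k)
  have h6 := le_abs_self (digitFreq k)
  unfold centredInd
  exact abs_le.2 ⟨by linarith [h1.2, h2.1], by linarith [h1.1, h2.2]⟩

/-! ### Spectral bounds -/

lemma tsum_mul_exp_mem_Icc {p X : ℕ → ℝ} {m M β : ℝ} (hp : ∀ a, 0 ≤ p a) (h1 : HasSum p 1)
    (hm : HasSum (fun a => p a * X a) m) (hX : ∀ a, |X a| ≤ M) (hβ : |β| * M ≤ 1) :
    ∑' a, p a * Real.exp (β * X a) ∈ Icc (1 + β * m) (1 + β * m + (β * M) ^ 2) := by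
  have ht : ∀ a, |β * X a| ≤ |β| * M := fun a => by
    rw [abs_mul]; exact mul_le_mul_of_nonneg_left (hX a) (abs_nonneg β)
  have hlow : ∀ a, p a + β * (p a * X a) ≤ p a * Real.exp (β * X a) := fun a => by
    nlinarith [hp a, Real.add_one_le_exp (β * X a)]
  have hup : ∀ a, p a * Real.exp (β * X a) ≤
      p a + β * (p a * X a) + p a * (β * M) ^ 2 := fun a => by
    have e1 := (abs_le.1 (Real.abs_exp_sub_one_sub_id_le ((ht a).trans hβ))).2
    have e2 : (β * X a) ^ 2 ≤ (β * M) ^ 2 := by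
      rw [← sq_abs, ← sq_abs (β * M), abs_mul β M]
      exact pow_le_pow_left₀ (abs_nonneg _)
        ((ht a).trans (mul_le_mul_of_nonneg_left (le_abs_self M) (abs_nonneg β))) 2
    nlinarith [hp a, mul_le_mul_of_nonneg_left (e1.trans e2) (hp a)]
  have hs1 := h1.add (hm.mul_left β)
  have hs2 : HasSum (fun a => p a + β * (p a * X a) + p a * (β * M) ^ 2)
      (1 + β * m + (β * M) ^ 2) := by
    simpa using hs1.add (h1.mul_right ((β * M) ^ 2))
  have hs : Summable fun a => p a * Real.exp (β * X a) :=
    Summable.of_nonneg_of_le (fun a => mul_nonneg (hp a) (Real.exp_pos _).le) hup hs2.summable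
  exact ⟨hasSum_le hlow hs1 hs.hasSum, hasSum_le hup hs.hasSum hs2⟩

lemma transfer_corrected {k : ℕ} (hk : 1 ≤ k) (β : ℝ) (N : ℕ) {y : ℝ} (hy : y ∈ Icc (0 : ℝ) 1) :
    transfer β k (fun z => ENNReal.ofReal ((1 + z)⁻¹ * Real.exp (β * corrector k N z))) y =
      ENNReal.ofReal (Real.exp (β * digitFreq k) *
        (∑' a, branchProb a y * Real.exp (β * centredInd k N y a)) *
          ((1 + y)⁻¹ * Real.exp (β * corrector k N y))) := by
  rw [transfer_density_mul β k (M := Real.exp (|β| * N)) _ hy]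
  · congr 1
    rw [mul_comm (Real.exp (β * digitFreq k)), mul_assoc, ← tsum_mul_right, ← tsum_mul_left]
    refine tsum_congr fun a => ?_
    have : β * digitInd k a + β * corrector k N (branch a y) =
        β * centredInd k N y a + β * digitFreq k + β * corrector k N y := by
      unfold centredInd; ring
    rw [← Real.exp_add, this, Real.exp_add, Real.exp_add]
    ring
  · intro z hz
    refine ⟨(Real.exp_pos _).le, Real.exp_le_exp.2 ((le_abs_self _).trans ?_)⟩
    rw [abs_mul]
    exact mul_le_mul_of_nonneg_left (abs_corrector_le hk N z hz) (abs_nonneg β)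

lemma density_mul_exp_corrector_bounds {k : ℕ} (hk : 1 ≤ k) (β : ℝ) (N : ℕ) :
    ∀ y ∈ Icc (0 : ℝ) 1, 1 / 2 * Real.exp (-(|β| * N)) ≤
      (1 + y)⁻¹ * Real.exp (β * corrector k N y) ∧
      (1 + y)⁻¹ * Real.exp (β * corrector k N y) ≤ Real.exp (|β| * N) := by
  intro y hy
  have h : |β * corrector k N y| ≤ |β| * N := by
    rw [abs_mul]
    exact mul_le_mul_of_nonneg_left (abs_corrector_le hk N y hy) (abs_nonneg β)
  have hy0 := hy.1
  have h1 : 1 / 2 ≤ (1 + y)⁻¹ := by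
    rw [one_div]; exact inv_anti₀ (by linarith) (by linarith [hy.2])
  have h2 : (1 + y)⁻¹ ≤ 1 := inv_le_one_of_one_le₀ (by linarith)
  refine ⟨mul_le_mul h1 (Real.exp_le_exp.2 (abs_le.1 h).1) (Real.exp_pos _).le (by positivity), ?_⟩
  simpa using mul_le_mul h2 (Real.exp_le_exp.2 (abs_le.1 h).2) (Real.exp_pos _).le zero_le_one

/-- Exponential bounds on the partition functions with rates `exp (β * digitFreq k)` up to
relative errors of order `|β| * 2 ^ (-N)` and `β ^ 2`. -/
lemma partitionFn_bounds {k : ℕ} (hk : 1 ≤ k) (N : ℕ) {β M : ℝ}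
    (hM : M = 2 * N + 1 + |digitFreq k|) (hβ : |β| * M ≤ 1)
    (hε : |β| * (2 * (1 / 2) ^ N) ≤ 1) :
    ∃ c > 0, ∃ C > 0, ∀ n,
      ENNReal.ofReal (c * (Real.exp (β * digitFreq k) * (1 - |β| * (2 * (1 / 2) ^ N))) ^ n) ≤
        partitionFn β k n 0 ∧
      partitionFn β k n 0 ≤ ENNReal.ofReal (C *
        (Real.exp (β * digitFreq k) * (1 + |β| * (2 * (1 / 2) ^ N) + (β * M) ^ 2)) ^ n) := by
  have hφ := density_mul_exp_corrector_bounds hk β N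
  have hc : 0 < 1 / 2 * Real.exp (-(|β| * N)) := by positivity
  have hS : ∀ y ∈ Icc (0 : ℝ) 1, ∑' a, branchProb a y * Real.exp (β * centredInd k N y a) ∈
      Icc (1 - |β| * (2 * (1 / 2) ^ N)) (1 + |β| * (2 * (1 / 2) ^ N) + (β * M) ^ 2) := by
    intro y hy
    have h := tsum_mul_exp_mem_Icc (fun a => branchProb_nonneg a hy.1) (hasSum_branchProb hy.1)
      (hasSum_branchProb_mul_centredInd hk N hy)
      (fun a => (abs_centredInd_le hk N hy a).trans_eq hM.symm) hβ
    have hd : |β * (digitProb k N y - digitFreq k)| ≤ |β| * (2 * (1 / 2) ^ N) := by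
      rw [abs_mul]
      exact mul_le_mul_of_nonneg_left (abs_digitProb_sub_digitFreq_le hk N hy) (abs_nonneg β)
    exact ⟨by linarith [h.1, (abs_le.1 hd).1], by linarith [h.2, (abs_le.1 hd).2]⟩
  have hpos : ∀ y ∈ Icc (0 : ℝ) 1, 0 ≤ (1 + y)⁻¹ * Real.exp (β * corrector k N y) := fun y hy =>
    hc.le.trans (hφ y hy).1
  refine ⟨_, div_pos hc (Real.exp_pos (|β| * N)), _, div_pos (Real.exp_pos (|β| * N)) hc,
    fun n => ⟨?_, ?_⟩⟩
  · refine le_partitionFn hc hφ (mul_nonneg (Real.exp_pos _).le (by linarith)) (fun y hy => ?_) n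
    rw [transfer_corrected hk β N hy]
    exact ENNReal.ofReal_le_ofReal (mul_le_mul_of_nonneg_right
      (mul_le_mul_of_nonneg_left (hS y hy).1 (Real.exp_pos _).le) (hpos y hy))
  · refine partitionFn_le hc hφ (by positivity) (fun y hy => ?_) n
    rw [transfer_corrected hk β N hy]
    exact ENNReal.ofReal_le_ofReal (mul_le_mul_of_nonneg_right
      (mul_le_mul_of_nonneg_left (hS y hy).2 (Real.exp_pos _).le) (hpos y hy))

lemma partitionFn_crude_bounds (k : ℕ) (β : ℝ) :
    ∃ c > 0, ∃ C > 0, ∀ n,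
      ENNReal.ofReal (c * Real.exp (-|β|) ^ n) ≤ partitionFn β k n 0 ∧
      partitionFn β k n 0 ≤ ENNReal.ofReal (C * Real.exp |β| ^ n) := by
  have hφ : ∀ y ∈ Icc (0 : ℝ) 1, 1 / 2 ≤ (1 + y)⁻¹ * (1 : ℝ) ∧ (1 + y)⁻¹ * (1 : ℝ) ≤ 1 := by
    intro y hy
    rw [mul_one, one_div]
    exact ⟨inv_anti₀ (by linarith [hy.1]) (by linarith [hy.2]),
      inv_le_one_of_one_le₀ (by linarith [hy.1])⟩
  have hexp : ∀ a, |β * digitInd k a| ≤ |β| := fun a => by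
    rw [abs_mul, abs_of_nonneg (digitInd_nonneg k a)]
    exact mul_le_of_le_one_right (abs_nonneg β) (digitInd_le_one k a)
  have hS : ∀ y ∈ Icc (0 : ℝ) 1,
      ∑' a, branchProb a y * (Real.exp (β * digitInd k a) * 1) ∈
        Icc (Real.exp (-|β|)) (Real.exp |β|) := by
    intro y hy
    have hs : Summable fun a => branchProb a y * (Real.exp (β * digitInd k a) * 1) :=
      summable_branchProb_mul (M := Real.exp |β|) hy.1 fun a => by
        rw [mul_one, abs_of_pos (Real.exp_pos _)]
        exact Real.exp_le_exp.2 ((le_abs_self _).trans (hexp a))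
    have hc : ∀ c, HasSum (fun a => branchProb a y * c) c := fun c => by
      simpa using (hasSum_branchProb hy.1).mul_right c
    exact ⟨hasSum_le (fun a => mul_le_mul_of_nonneg_left
        (by rw [mul_one]; exact Real.exp_le_exp.2 (abs_le.1 (hexp a)).1)
        (branchProb_nonneg a hy.1)) (hc _) hs.hasSum,
      hasSum_le (fun a => mul_le_mul_of_nonneg_left
        (by rw [mul_one]; exact Real.exp_le_exp.2 (abs_le.1 (hexp a)).2)
        (branchProb_nonneg a hy.1)) hs.hasSum (hc _)⟩
  have hf : ∀ y ∈ Icc (0 : ℝ) 1, (fun _ : ℝ => (1 : ℝ)) y ∈ Icc (0 : ℝ) 1 := fun y _ => by simp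
  refine ⟨1 / 2 / 1, by norm_num, 1 / (1 / 2), by norm_num, fun n => ⟨?_, ?_⟩⟩
  · refine le_partitionFn (by norm_num) hφ (Real.exp_pos _).le (fun y hy => ?_) n
    rw [transfer_density_mul β k hf hy, mul_one, mul_comm (Real.exp _)]
    exact ENNReal.ofReal_le_ofReal (mul_le_mul_of_nonneg_left (hS y hy).1
      (inv_nonneg.2 (by linarith [hy.1])))
  · refine partitionFn_le (by norm_num) hφ (Real.exp_pos _).le (fun y hy => ?_) n
    rw [transfer_density_mul β k hf hy, mul_one, mul_comm (Real.exp _)]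
    exact ENNReal.ofReal_le_ofReal (mul_le_mul_of_nonneg_left (hS y hy).2
      (inv_nonneg.2 (by linarith [hy.1])))

lemma partitionFn_ne_top (β : ℝ) (k n : ℕ) : partitionFn β k n 0 ≠ ⊤ := by
  obtain ⟨c, -, C, -, h⟩ := partitionFn_crude_bounds k β
  exact ne_top_of_le_ne_top ENNReal.ofReal_ne_top (h n).2

lemma toReal_partitionFn_pos (β : ℝ) (k n : ℕ) : 0 < (partitionFn β k n 0).toReal := by
  obtain ⟨c, hc, C, -, h⟩ := partitionFn_crude_bounds k β
  refine ENNReal.toReal_pos (ne_of_gt (lt_of_lt_of_le ?_ (h n).1)) (partitionFn_ne_top β k n)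
  exact ENNReal.ofReal_pos.2 (mul_pos hc (pow_pos (Real.exp_pos _) n))

/-! ### Existence of the pressure -/

lemma tendsto_inv_mul_const (c : ℝ) : Tendsto (fun n : ℕ => (n : ℝ)⁻¹ * c) atTop (𝓝 0) := by
  simpa using (tendsto_inv_atTop_nhds_zero_nat (𝕜 := ℝ)).mul_const c

lemma inv_mul_log_mul_pow {c r : ℝ} (hc : 0 < c) (hr : 0 < r) {n : ℕ} (hn : n ≠ 0) :
    (n : ℝ)⁻¹ * Real.log (c * r ^ n) = (n : ℝ)⁻¹ * Real.log c + Real.log r := by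
  rw [Real.log_mul hc.ne' (pow_pos hr n).ne', Real.log_pow, mul_add, inv_mul_cancel_left₀]
  exact_mod_cast hn

lemma tendsto_inv_mul_log_mul_pow {c r : ℝ} (hc : 0 < c) (hr : 0 < r) :
    Tendsto (fun n : ℕ => (n : ℝ)⁻¹ * Real.log (c * r ^ n)) atTop (𝓝 (Real.log r)) := by
  have h := (tendsto_inv_mul_const (Real.log c)).add_const (Real.log r)
  rw [zero_add] at h
  refine h.congr' ?_
  filter_upwards [eventually_ne_atTop 0] with n hn
  exact (inv_mul_log_mul_pow hc hr hn).symm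

lemma exists_tendsto_pressure (β : ℝ) (k : ℕ) :
    ∃ q, Tendsto (fun n : ℕ => (n : ℝ)⁻¹ * Real.log (partitionFn β k n 0).toReal) atTop (𝓝 q) := by
  have hpos := toReal_partitionFn_pos β k
  have hsub : Subadditive fun n => Real.log (4 * (partitionFn β k n 0).toReal) := by
    intro m n
    have hm := hpos m
    have hn := hpos n
    rw [← Real.log_mul (by positivity) (by positivity)]
    refine Real.log_le_log (mul_pos four_pos (hpos _)) ?_
    have h := ENNReal.toReal_mono
      (by finiteness [partitionFn_ne_top β k m, partitionFn_ne_top β k n])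
      (partitionFn_add_le β k m n)
    rw [ENNReal.toReal_mul, ENNReal.toReal_mul] at h
    norm_num at h
    linarith
  have hbdd : BddBelow (range fun n : ℕ => Real.log (4 * (partitionFn β k n 0).toReal) / n) := by
    obtain ⟨c, hc, C, -, h⟩ := partitionFn_crude_bounds k β
    have ht := tendsto_inv_mul_log_mul_pow (mul_pos four_pos hc) (Real.exp_pos (-|β|))
    obtain ⟨b, hb⟩ := ht.bddBelow_range
    refine ⟨b, ?_⟩
    rintro _ ⟨n, rfl⟩
    refine (hb ⟨n, rfl⟩).trans ?_
    have e := (ENNReal.ofReal_le_iff_le_toReal (partitionFn_ne_top β k n)).1 (h n).1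
    simp only
    rw [div_eq_inv_mul]
    refine mul_le_mul_of_nonneg_left (Real.log_le_log (by positivity) ?_) (by positivity)
    linarith
  refine ⟨hsub.lim, ?_⟩
  have h := (hsub.tendsto_lim hbdd).sub (tendsto_inv_mul_const (Real.log 4))
  rw [sub_zero] at h
  refine h.congr fun n => ?_
  rw [Real.log_mul four_ne_zero (hpos n).ne', div_eq_inv_mul]
  ring

/-- The free energy of the occurrences of the digit `k`. -/
noncomputable def pressure (k : ℕ) (β : ℝ) : ℝ := (exists_tendsto_pressure β k).choose

lemma tendsto_pressure (β : ℝ) (k : ℕ) :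
    Tendsto (fun n : ℕ => (n : ℝ)⁻¹ * Real.log (partitionFn β k n 0).toReal) atTop
      (𝓝 (pressure k β)) :=
  (exists_tendsto_pressure β k).choose_spec

lemma tendsto_pressure_of_comparable (β : ℝ) (k : ℕ) {A : ℕ → ℝ≥0∞}
    (h : ∀ n, 1 ≤ n → A n ≤ 4 * partitionFn β k n 0 ∧ partitionFn β k n 0 ≤ 4 * A n) :
    Tendsto (fun n : ℕ => (n : ℝ)⁻¹ * Real.log (A n).toReal) atTop (𝓝 (pressure k β)) := by
  have ht := tendsto_pressure β k
  have h4 := tendsto_inv_mul_const (Real.log 4)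
  have hbounds : ∀ n : ℕ, 1 ≤ n →
      Real.log (partitionFn β k n 0).toReal - Real.log 4 ≤ Real.log (A n).toReal ∧
      Real.log (A n).toReal ≤ Real.log (partitionFn β k n 0).toReal + Real.log 4 := by
    intro n hn
    obtain ⟨h1, h2⟩ := h n hn
    have hZ := toReal_partitionFn_pos β k n
    have hZt := partitionFn_ne_top β k n
    have hA : A n ≠ ⊤ := ne_top_of_le_ne_top (ENNReal.mul_ne_top (by norm_num) hZt) h1
    have e1 := ENNReal.toReal_mono (ENNReal.mul_ne_top (by norm_num) hZt) h1
    have e2 := ENNReal.toReal_mono (ENNReal.mul_ne_top (by norm_num) hA) h2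
    rw [ENNReal.toReal_mul] at e1 e2
    norm_num at e1 e2
    have hA0 : 0 < (A n).toReal := by linarith
    rw [sub_le_iff_le_add, ← Real.log_mul hA0.ne' four_ne_zero,
      ← Real.log_mul hZ.ne' four_ne_zero]
    exact ⟨Real.log_le_log hZ (by linarith), Real.log_le_log hA0 (by linarith)⟩
  refine tendsto_of_tendsto_of_tendsto_of_le_of_le' (by simpa using ht.sub h4)
    (by simpa using ht.add h4) ?_ ?_
  · filter_upwards [eventually_ge_atTop 1] with n hn
    rw [← mul_sub]
    exact mul_le_mul_of_nonneg_left (hbounds n hn).1 (by positivity)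
  · filter_upwards [eventually_ge_atTop 1] with n hn
    rw [← mul_add]
    exact mul_le_mul_of_nonneg_left (hbounds n hn).2 (by positivity)

/-! ### Differentiability at zero -/

lemma pressure_le {β : ℝ} {k : ℕ} {C r : ℝ} (hC : 0 < C) (hr : 0 < r)
    (h : ∀ n, partitionFn β k n 0 ≤ ENNReal.ofReal (C * r ^ n)) : pressure k β ≤ Real.log r := by
  refine le_of_tendsto_of_tendsto' (tendsto_pressure β k) (tendsto_inv_mul_log_mul_pow hC hr)
    fun n => mul_le_mul_of_nonneg_left ?_ (by positivity)
  exact Real.log_le_log (toReal_partitionFn_pos β k n)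
    (ENNReal.toReal_le_of_le_ofReal (by positivity) (h n))

lemma le_pressure {β : ℝ} {k : ℕ} {c r : ℝ} (hc : 0 < c) (hr : 0 < r)
    (h : ∀ n, ENNReal.ofReal (c * r ^ n) ≤ partitionFn β k n 0) : Real.log r ≤ pressure k β := by
  refine le_of_tendsto_of_tendsto' (tendsto_inv_mul_log_mul_pow hc hr) (tendsto_pressure β k)
    fun n => mul_le_mul_of_nonneg_left ?_ (by positivity)
  exact Real.log_le_log (by positivity)
    ((ENNReal.ofReal_le_iff_le_toReal (partitionFn_ne_top β k n)).1 (h n))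

lemma abs_pressure_sub_le {k : ℕ} (hk : 1 ≤ k) (N : ℕ) {β M : ℝ}
    (hM : M = 2 * N + 1 + |digitFreq k|) (hβ : |β| * M ≤ 1)
    (hε : |β| * (2 * (1 / 2) ^ N) ≤ 1 / 2) :
    |pressure k β - β * digitFreq k| ≤ 2 * (|β| * (2 * (1 / 2) ^ N)) + (β * M) ^ 2 := by
  obtain ⟨c, hc, C, hC, h⟩ := partitionFn_bounds hk N hM hβ (hε.trans (by norm_num))
  set ε := |β| * (2 * (1 / 2) ^ N) with hεdef
  have hε0 : 0 ≤ ε := by positivity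
  have hlow := le_pressure hc (mul_pos (Real.exp_pos _) (by linarith)) fun n => (h n).1
  have hup := pressure_le hC (by positivity) fun n => (h n).2
  rw [Real.log_mul (Real.exp_pos _).ne' (by linarith), Real.log_exp] at hlow
  rw [Real.log_mul (Real.exp_pos _).ne' (by positivity), Real.log_exp] at hup
  have e1 := Real.log_le_sub_one_of_pos (show 0 < 1 + ε + (β * M) ^ 2 by positivity)
  have e2 := Real.one_sub_inv_le_log_of_pos (show 0 < 1 - ε by linarith)
  have e3 : (1 - ε)⁻¹ ≤ 1 + 2 * ε := by
    rw [inv_le_iff_one_le_mul₀ (by linarith)]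
    nlinarith
  have := sq_nonneg (β * M)
  exact abs_le.2 ⟨by linarith, by linarith⟩

lemma hasDerivAt_pressure {k : ℕ} (hk : 1 ≤ k) : HasDerivAt (pressure k) (digitFreq k) 0 := by
  have h0 : pressure k 0 = 0 := by
    have h := abs_pressure_sub_le hk 0 (β := 0) rfl (by simp) (by simp)
    simpa using h
  rw [hasDerivAt_iff_isLittleO, Asymptotics.isLittleO_iff]
  intro δ hδ
  obtain ⟨N, hN⟩ := exists_pow_lt_of_lt_one (show 0 < δ / 8 by positivity)
    (show (1 / 2 : ℝ) < 1 by norm_num)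
  set M : ℝ := 2 * N + 1 + |digitFreq k| with hM
  have hM0 : 0 < M := by positivity
  have hsmall : ∀ c > 0, ∀ᶠ β : ℝ in 𝓝 0, |β| < c := fun c hc => by
    simpa using eventually_abs_sub_lt (0 : ℝ) hc
  filter_upwards [hsmall (1 / M) (by positivity), hsmall (1 / 4) (by norm_num),
    hsmall (δ / (2 * M ^ 2)) (by positivity)] with β h1 h2 h3
  have hp1 : (1 / 2 : ℝ) ^ N ≤ 1 := pow_le_one₀ (by norm_num) (by norm_num)
  have hp0 : (0 : ℝ) ≤ (1 / 2) ^ N := by positivity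
  have h := abs_pressure_sub_le hk N hM ((lt_div_iff₀ hM0).1 h1).le
    (by nlinarith [abs_nonneg β])
  rw [h0, sub_zero, sub_zero, smul_eq_mul, Real.norm_eq_abs, Real.norm_eq_abs]
  refine h.trans ?_
  rw [lt_div_iff₀ (by positivity)] at h3
  have e : (β * M) ^ 2 = |β| * (|β| * M ^ 2) := by rw [mul_pow, ← sq_abs β]; ring
  rw [e]
  nlinarith [abs_nonneg β, mul_le_mul_of_nonneg_left hN.le (abs_nonneg β),
    mul_le_mul_of_nonneg_left h3.le (abs_nonneg β)]

end GaussFreeEnergy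

/-- **Differentiability of the free energies of digit counts.** For each digit `k ≥ 1`, the
limits `Q(β)` of `(1/n) log` of the moment generating quantities of `F_{k,n}` (under Lebesgue
measure, over weighted periodic points of the Gauss map, and over weighted preimages of any
`y ∈ π(S^ℕ)`) exist for all `β`, are differentiable at `β = 0`, and their derivatives there
all equal the Gauss-measure frequency `(1/log 2) log((k+1)²/(k(k+2)))` of the digit `k`. -/
theorem continued_fraction_digit_free_energy (k : ℕ) (hk : 1 ≤ k) :
    (∃ Q : ℝ → ℝ,
      (∀ β : ℝ,
        Tendsto (fun n : ℕ => (n : ℝ)⁻¹ *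
            Real.log (∫ x in Set.Ioo (0 : ℝ) 1, Real.exp (β * (digitCount k n x : ℝ))))
          atTop (nhds (Q β))) ∧
      HasDerivAt Q
        (Real.log (((k : ℝ) + 1) ^ 2 / ((k : ℝ) * ((k : ℝ) + 2))) / Real.log 2) 0) ∧
    (∃ Q : ℝ → ℝ,
      (∀ β : ℝ,
        Tendsto (fun n : ℕ => (n : ℝ)⁻¹ *
            Real.log (∑' x : {x : ℝ // x ∈ Set.Ioo (0 : ℝ) 1 ∧ Irrational x ∧
                gaussMap^[n] x = x},
              Real.exp (β * (digitCount k n (x : ℝ) : ℝ)) *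
                |deriv (gaussMap^[n]) (x : ℝ)|⁻¹))
          atTop (nhds (Q β))) ∧
      HasDerivAt Q
        (Real.log (((k : ℝ) + 1) ^ 2 / ((k : ℝ) * ((k : ℝ) + 2))) / Real.log 2) 0) ∧
    ∀ y : ℝ, y ∈ Set.range cfPi →
      ∃ Q : ℝ → ℝ,
        (∀ β : ℝ,
          Tendsto (fun n : ℕ => (n : ℝ)⁻¹ *
              Real.log (∑' x : {x : ℝ // x ∈ Set.Ioo (0 : ℝ) 1 ∧ Irrational x ∧
                  gaussMap^[n] x = y},
                Real.exp (β * (digitCount k n (x : ℝ) : ℝ)) *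
                  |deriv (gaussMap^[n]) (x : ℝ)|⁻¹))
            atTop (nhds (Q β))) ∧
        HasDerivAt Q
          (Real.log (((k : ℝ) + 1) ^ 2 / ((k : ℝ) * ((k : ℝ) + 2))) / Real.log 2) 0 := by
  have hQ := GaussFreeEnergy.hasDerivAt_pressure hk
  refine ⟨⟨_, fun β => ?_, hQ⟩, ⟨_, fun β => ?_, hQ⟩, ?_⟩
  · simp only [GaussFreeEnergy.integral_exp_digitCount hk]
    exact GaussFreeEnergy.tendsto_pressure_of_comparable β k fun n _ =>
      GaussFreeEnergy.setLIntegral_partitionFn_le β k n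
  · choose! z hz hsum using fun (n : ℕ) (hn : 1 ≤ n) => GaussFreeEnergy.tsum_periodic hk β hn
    refine (GaussFreeEnergy.tendsto_pressure_of_comparable β k fun n hn =>
      GaussFreeEnergy.tsum_wordWeight_le β k n (hz n hn)).congr' ?_
    filter_upwards [eventually_ge_atTop 1] with n hn
    rw [hsum n hn]
  · rintro _ ⟨x, rfl⟩
    have hx := GaussFreeEnergy.cfPi_mem_Ioo x
    have h0 : (0 : ℝ) ∈ Icc (0 : ℝ) 1 := by simp
    refine ⟨_, fun β => ?_, hQ⟩
    simp only [GaussFreeEnergy.tsum_preimages hk β _ hx (GaussFreeEnergy.irrational_cfPi x)]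
    exact GaussFreeEnergy.tendsto_pressure_of_comparable β k fun n _ =>
      ⟨GaussFreeEnergy.partitionFn_le_four_mul β k n (Ioo_subset_Icc_self hx) h0,
        GaussFreeEnergy.partitionFn_le_four_mul β k n h0 (Ioo_subset_Icc_self hx)⟩
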